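/- arXiv:1406.2929 — 13 statements merged into one kernel-verified Lean document; each statement's English description precedes it below -/
import Mathlib

section
/- Let k₁ < k₂ be real constants, b > 0, ε ∈ {1, −1}, and let φ be the function φ(s) = ((1+k₁s²)(1+k₂s²))^{1/4}·exp(∫₀ˢ εc/(2(1+k₁t²)√(1+k₂t²)) dt) with c = √(k₂−k₁). Then 1 + k₁b² > 0 if and only if for every real s with |s| ≤ b one has 1 + k₁s² > 0, φ(s) > 0, φ(s) − s·φ′(s) > 0, and φ(s) − s·φ′(s) + (b² − s²)·φ″(s) > 0. -/
lemma aux_pos (k s t : ℝ) (h : 0 < 1 + k * s ^ 2) (ht : |t| ≤ |s|) : 0 < 1 + k * t ^ 2 := by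
  have h2 : t ^ 2 ≤ s ^ 2 := sq_le_sq.mpr ht
  rcases le_or_gt 0 k with hk | hk
  · positivity
  · nlinarith

lemma aux_deriv (k₁ k₂ e : ℝ) (hk : k₁ < k₂) (φ : ℝ → ℝ)
    (hφ : φ = fun s : ℝ => ((1 + k₁ * s ^ 2) * (1 + k₂ * s ^ 2)) ^ ((1 : ℝ) / 4) *
      Real.exp (∫ t in (0 : ℝ)..s,
        e / (2 * (1 + k₁ * t ^ 2) * Real.sqrt (1 + k₂ * t ^ 2))))
    (s : ℝ) (hA : 0 < 1 + k₁ * s ^ 2) :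
    HasDerivAt φ (φ s * (s * k₁ / (2 * (1 + k₁ * s ^ 2)) + s * k₂ / (2 * (1 + k₂ * s ^ 2))
      + e / (2 * (1 + k₁ * s ^ 2) * Real.sqrt (1 + k₂ * s ^ 2)))) s := by
  have hBA : ∀ t : ℝ, 0 < 1 + k₁ * t ^ 2 → 0 < 1 + k₂ * t ^ 2 := fun t ht => by
    nlinarith [sq_nonneg t]
  have hB := hBA s hA
  set g : ℝ → ℝ := fun t => e / (2 * (1 + k₁ * t ^ 2) * Real.sqrt (1 + k₂ * t ^ 2)) with hg
  have hU : IsOpen {t : ℝ | 0 < 1 + k₁ * t ^ 2} :=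
    isOpen_lt continuous_const (by fun_prop)
  have hcont : ContinuousOn g {t : ℝ | 0 < 1 + k₁ * t ^ 2} := by
    refine ContinuousOn.div (by fun_prop) (by fun_prop) ?_
    intro t ht
    have h1 : 0 < 1 + k₁ * t ^ 2 := ht
    have h2 := Real.sqrt_pos.mpr (hBA t h1)
    positivity
  have hI : HasDerivAt (fun x => ∫ t in (0 : ℝ)..x, g t) (g s) s := by
    refine intervalIntegral.integral_hasDerivAt_right ?_ ?_ ?_
    · refine ContinuousOn.intervalIntegrable (hcont.mono ?_)
      intro t ht
      refine aux_pos k₁ s t hA ?_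
      have := Set.abs_sub_left_of_mem_uIcc ht
      simpa using this
    · exact hcont.stronglyMeasurableAtFilter hU s hA
    · exact hcont.continuousAt (hU.mem_nhds hA)
  have hAd : HasDerivAt (fun x : ℝ => 1 + k₁ * x ^ 2) (k₁ * (2 * s)) s := by
    simpa using ((hasDerivAt_pow 2 s).const_mul k₁).const_add 1
  have hBd : HasDerivAt (fun x : ℝ => 1 + k₂ * x ^ 2) (k₂ * (2 * s)) s := by
    simpa using ((hasDerivAt_pow 2 s).const_mul k₂).const_add 1
  have hAB : (1 + k₁ * s ^ 2) * (1 + k₂ * s ^ 2) ≠ 0 := (mul_pos hA hB).ne'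
  have hP := (hAd.mul hBd).rpow_const (p := (1 : ℝ) / 4) (Or.inl hAB)
  have := hP.mul hI.exp
  rw [hφ]
  refine this.congr_deriv ?_
  simp only [Pi.mul_apply]
  rw [Real.rpow_sub_one hAB]
  have hgs : g s = e / (2 * (1 + k₁ * s ^ 2) * Real.sqrt (1 + k₂ * s ^ 2)) := rfl
  rw [hgs]
  have hR := Real.sqrt_pos.mpr hB
  generalize ((1 + k₁ * s ^ 2) * (1 + k₂ * s ^ 2)) ^ ((1 : ℝ) / 4) = P
  generalize Real.exp _ = E
  clear hgs this hP
  generalize Real.sqrt (1 + k₂ * s ^ 2) = R at *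
  have hA' := hA.ne'
  have hB' := hB.ne'
  have hR' := hR.ne'
  clear hI hAB hA hB hR hφ
  generalize 1 + k₁ * s ^ 2 = A at *
  generalize 1 + k₂ * s ^ 2 = B at *
  field_simp
  ring

lemma aux_deriv2 (k₁ k₂ e s : ℝ) (hA : 0 < 1 + k₁ * s ^ 2) (hB : 0 < 1 + k₂ * s ^ 2) :
    HasDerivAt (fun s : ℝ => s * k₁ / (2 * (1 + k₁ * s ^ 2)) + s * k₂ / (2 * (1 + k₂ * s ^ 2))
      + e / (2 * (1 + k₁ * s ^ 2) * Real.sqrt (1 + k₂ * s ^ 2)))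
      (k₁ * (1 - k₁ * s ^ 2) / (2 * (1 + k₁ * s ^ 2) ^ 2)
      + k₂ * (1 - k₂ * s ^ 2) / (2 * (1 + k₂ * s ^ 2) ^ 2)
      - e / (2 * (1 + k₁ * s ^ 2) * Real.sqrt (1 + k₂ * s ^ 2)) *
        (2 * k₁ * s / (1 + k₁ * s ^ 2) + k₂ * s / (1 + k₂ * s ^ 2))) s := by
  have hAd : HasDerivAt (fun x : ℝ => 1 + k₁ * x ^ 2) (k₁ * (2 * s)) s := by
    simpa using ((hasDerivAt_pow 2 s).const_mul k₁).const_add 1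
  have hBd : HasDerivAt (fun x : ℝ => 1 + k₂ * x ^ 2) (k₂ * (2 * s)) s := by
    simpa using ((hasDerivAt_pow 2 s).const_mul k₂).const_add 1
  have hR := Real.sqrt_pos.mpr hB
  have h1 := ((hasDerivAt_id' s).mul_const k₁).fun_div (hAd.const_mul 2) (by positivity)
  have h2 := ((hasDerivAt_id' s).mul_const k₂).fun_div (hBd.const_mul 2) (by positivity)
  have h3 := (hasDerivAt_const s e).fun_div ((hAd.const_mul 2).fun_mul (hBd.sqrt hB.ne'))
    (by positivity)
  refine ((h1.fun_add h2).fun_add h3).congr_deriv ?_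
  have hRR : Real.sqrt (1 + k₂ * s ^ 2) ^ 2 = 1 + k₂ * s ^ 2 := Real.sq_sqrt hB.le
  generalize Real.sqrt (1 + k₂ * s ^ 2) = R at *
  congr 1
  · congr 1
    · field_simp; ring
    · field_simp; ring
  · rw [← hRR]
    field_simp
    ring

/-- the algebraic identity -/
lemma aux_alg (k₁ k₂ e s R A B : ℝ) (hAe : A = 1 + k₁ * s ^ 2) (hBe : B = 1 + k₂ * s ^ 2)
    (hA : 0 < A) (hB : 0 < B) (hR : 0 < R) (hRR : R ^ 2 = B) (he : e ^ 2 = k₂ - k₁) (u : ℝ)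
    (hu : u = s * k₁ / (2 * A) + s * k₂ / (2 * B) + e / (2 * A * R)) :
    A * (u ^ 2 + (k₁ * (1 - k₁ * s ^ 2) / (2 * A ^ 2) + k₂ * (1 - k₂ * s ^ 2) / (2 * B ^ 2)
      - e / (2 * A * R) * (2 * k₁ * s / A + k₂ * s / B))) - k₁ * (1 - s * u)
      = 3 * e ^ 2 / (4 * B ^ 2) := by
  have h1 : u ^ 2 = (s * k₁ / (2 * A) + s * k₂ / (2 * B)) ^ 2
      + 2 * (s * k₁ / (2 * A) + s * k₂ / (2 * B)) * (e / (2 * A * R)) + e ^ 2 / (4 * A ^ 2 * B) := by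
    rw [hu, ← hRR]; field_simp; ring
  have hk2 : k₂ = k₁ + e ^ 2 := by linarith
  rw [h1, hu]
  have hX : e / (2 * A * R) * A = e / (2 * R) := by field_simp
  generalize hT : e / (2 * A * R) = T at *
  clear h1 hu hX hT hRR
  subst hk2
  field_simp
  subst hAe hBe
  ring

lemma aux_p (k₁ k₂ e s R A B : ℝ) (hAe : A = 1 + k₁ * s ^ 2) (hBe : B = 1 + k₂ * s ^ 2)
    (hA : 0 < A) (hB : 0 < B) (hR : 0 < R) (hRR : R ^ 2 = B) (he : e ^ 2 = k₂ - k₁) (u : ℝ)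
    (hu : u = s * k₁ / (2 * A) + s * k₂ / (2 * B) + e / (2 * A * R)) :
    0 < 1 - s * u := by
  have h : 1 - s * u = (R - e * s) * (2 * R + e * s) / (2 * A * B) := by
    have h1 : e / (2 * A * R) = e * R / (2 * A * B) := by rw [← hRR]; field_simp
    have h2 : (R - e * s) * (2 * R + e * s) = 2 * B - e * s * R - (k₂ - k₁) * s ^ 2 := by
      rw [← he, ← hRR]; ring
    rw [hu, h1, h2]
    field_simp
    subst hAe hBe
    ring
  have hlt : (e * s) ^ 2 < R ^ 2 := by rw [mul_pow, he, hRR, hBe]; linarith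
  have := abs_lt.mp (abs_lt_of_sq_lt_sq hlt hR.le)
  rw [h]
  have h3 : 0 < R - e * s := by linarith
  have h4 : 0 < 2 * R + e * s := by linarith
  positivity

/-- Lemma 3.1 of the paper. Let `k₁ < k₂`, `b > 0`, `ε ∈ {1, -1}`,
`c = √(k₂ - k₁)`, and `φ(s) = ((1+k₁s²)(1+k₂s²))^{1/4} · exp(∫₀ˢ εc/(2(1+k₁t²)√(1+k₂t²)) dt)`.
Then `1 + k₁b² > 0` iff for every `s` with `|s| ≤ b` one has `1 + k₁s² > 0`, `φ(s) > 0`,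
`φ(s) - s·φ'(s) > 0` and `φ(s) - s·φ'(s) + (b² - s²)·φ''(s) > 0`. -/
theorem stmt_0 (k₁ k₂ b ε c : ℝ) (hk : k₁ < k₂) (hb : 0 < b)
    (hε : ε = 1 ∨ ε = -1) (hc : c = Real.sqrt (k₂ - k₁))
    (φ : ℝ → ℝ)
    (hφ : φ = fun s : ℝ => ((1 + k₁ * s ^ 2) * (1 + k₂ * s ^ 2)) ^ ((1 : ℝ) / 4) *
      Real.exp (∫ t in (0 : ℝ)..s,
        ε * c / (2 * (1 + k₁ * t ^ 2) * Real.sqrt (1 + k₂ * t ^ 2)))) :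
    0 < 1 + k₁ * b ^ 2 ↔
      ∀ s : ℝ, |s| ≤ b →
        0 < 1 + k₁ * s ^ 2 ∧ 0 < φ s ∧ 0 < φ s - s * deriv φ s ∧
          0 < φ s - s * deriv φ s + (b ^ 2 - s ^ 2) * deriv (deriv φ) s := by
  have he : (ε * c) ^ 2 = k₂ - k₁ := by
    have : c ^ 2 = k₂ - k₁ := by rw [hc]; exact Real.sq_sqrt (by linarith)
    rcases hε with h | h <;> rw [h] <;> linarith
  constructor
  swap
  · intro h
    exact (h b (abs_of_pos hb).le).1
  intro hbp s hs
  have hA : 0 < 1 + k₁ * s ^ 2 := aux_pos k₁ b s hbp (by rwa [abs_of_pos hb])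
  have hB : 0 < 1 + k₂ * s ^ 2 := by nlinarith [sq_nonneg s]
  have hR := Real.sqrt_pos.mpr hB
  have hRR : Real.sqrt (1 + k₂ * s ^ 2) ^ 2 = 1 + k₂ * s ^ 2 := Real.sq_sqrt hB.le
  have hpos : 0 < φ s := by rw [hφ]; positivity
  have hd := fun x hx => aux_deriv k₁ k₂ (ε * c) hk φ hφ x hx
  have hU : IsOpen {t : ℝ | 0 < 1 + k₁ * t ^ 2} :=
    isOpen_lt continuous_const (by fun_prop)
  have hev := Filter.eventuallyEq_of_mem (hU.mem_nhds hA) (fun x hx => (hd x hx).deriv)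
  have hdd := ((hd s hA).mul (aux_deriv2 k₁ k₂ (ε * c) s hA hB)).deriv
  have hdd2 := hev.deriv_eq.trans hdd
  have hal := aux_alg k₁ k₂ (ε * c) s _ _ _ rfl rfl hA hB hR hRR he _ rfl
  have hp := aux_p k₁ k₂ (ε * c) s _ _ _ rfl rfl hA hB hR hRR he _ rfl
  rw [(hd s hA).deriv, hdd2]
  clear hdd2 hdd hev
  generalize s * k₁ / (2 * (1 + k₁ * s ^ 2)) + s * k₂ / (2 * (1 + k₂ * s ^ 2))
      + ε * c / (2 * (1 + k₁ * s ^ 2) * Real.sqrt (1 + k₂ * s ^ 2)) = u at *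
  generalize k₁ * (1 - k₁ * s ^ 2) / (2 * (1 + k₁ * s ^ 2) ^ 2)
      + k₂ * (1 - k₂ * s ^ 2) / (2 * (1 + k₂ * s ^ 2) ^ 2)
      - ε * c / (2 * (1 + k₁ * s ^ 2) * Real.sqrt (1 + k₂ * s ^ 2)) *
        (2 * k₁ * s / (1 + k₁ * s ^ 2) + k₂ * s / (1 + k₂ * s ^ 2)) = v at *
  refine ⟨hA, hpos, ?_, ?_⟩
  · have := mul_pos hpos hp
    linarith
  · have hq : 0 ≤ 3 * (ε * c) ^ 2 / (4 * (1 + k₂ * s ^ 2) ^ 2) := by positivity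
    rw [← hal] at hq
    have hs2 : 0 ≤ b ^ 2 - s ^ 2 := by
      have := sq_le_sq.mpr (hs.trans (le_abs_self b))
      linarith
    have h1 := mul_nonneg hs2 hq
    have h2 := mul_pos hp hbp
    have h3 : 0 < (1 + k₁ * s ^ 2) * ((1 - s * u) + (b ^ 2 - s ^ 2) * (u ^ 2 + v)) := by
      linarith
    have h4 := mul_pos hpos (pos_of_mul_pos_right h3 hA.le)
    linarith
end

section
/- Let k₁ < k₂ be real constants, ε ∈ {1, −1}, c = √(k₂−k₁), and let φ(s) = ((1+k₁s²)(1+k₂s²))^{1/4}·exp(∫₀ˢ εc/(2(1+k₁t²)√(1+k₂t²)) dt). Then for every real s with 1 + k₁s² > 0, φ(s) − s·φ′(s) = φ(s)/((1+k₁s²)(1+k₂s²)) · (√(1+k₂s²) − εcs)·(√(1+k₂s²) + ε(c/2)s). -/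
/-- With `k₁ < k₂`, `ε ∈ {1, -1}`, `c = √(k₂ - k₁)` and
`φ(s) = ((1+k₁s²)(1+k₂s²))^{1/4} · exp(∫₀ˢ εc/(2(1+k₁t²)√(1+k₂t²)) dt)`, for every real
`s` with `1 + k₁s² > 0` one has
`φ(s) - s·φ'(s) = φ(s)/((1+k₁s²)(1+k₂s²)) · (√(1+k₂s²) - εcs)·(√(1+k₂s²) + ε(c/2)s)`. -/
theorem stmt_1 (k₁ k₂ ε c : ℝ) (hk : k₁ < k₂)
    (hε : ε = 1 ∨ ε = -1) (hc : c = Real.sqrt (k₂ - k₁))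
    (φ : ℝ → ℝ)
    (hφ : φ = fun s : ℝ => ((1 + k₁ * s ^ 2) * (1 + k₂ * s ^ 2)) ^ ((1 : ℝ) / 4) *
      Real.exp (∫ t in (0 : ℝ)..s,
        ε * c / (2 * (1 + k₁ * t ^ 2) * Real.sqrt (1 + k₂ * t ^ 2)))) :
    ∀ s : ℝ, 0 < 1 + k₁ * s ^ 2 →
      φ s - s * deriv φ s =
        φ s / ((1 + k₁ * s ^ 2) * (1 + k₂ * s ^ 2)) *
          ((Real.sqrt (1 + k₂ * s ^ 2) - ε * c * s) *
            (Real.sqrt (1 + k₂ * s ^ 2) + ε * (c / 2) * s)) := by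
  intro s hs
  have hc2 : c ^ 2 = k₂ - k₁ := by rw [hc, Real.sq_sqrt (by linarith)]
  have hε2 : ε ^ 2 = 1 := by rcases hε with h | h <;> rw [h] <;> norm_num
  have hpos : ∀ t : ℝ, 0 < 1 + k₁ * t ^ 2 → 0 < 1 + k₂ * t ^ 2 := by
    intro t ht
    nlinarith [mul_nonneg (sub_nonneg.2 hk.le) (sq_nonneg t)]
  have hB := hpos s hs
  have hseg : ∀ t ∈ Set.uIcc (0 : ℝ) s, 0 < 1 + k₁ * t ^ 2 := by
    intro t ht
    have hts : t ^ 2 ≤ s ^ 2 := by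
      rcases Set.mem_uIcc.1 ht with h | h <;> nlinarith [h.1, h.2]
    rcases le_total 0 k₁ with h | h
    · nlinarith [mul_nonneg h (sq_nonneg t)]
    · nlinarith [mul_le_mul_of_nonpos_left hts h]
  have hcont : ∀ t : ℝ, 0 < 1 + k₁ * t ^ 2 → ContinuousAt (fun t : ℝ =>
      ε * c / (2 * (1 + k₁ * t ^ 2) * Real.sqrt (1 + k₂ * t ^ 2))) t := by
    intro t ht
    have h1 := Real.sqrt_pos.2 (hpos t ht)
    apply ContinuousAt.div
    · fun_prop
    · fun_prop
    · positivity
  have hmeas : Measurable (fun t : ℝ =>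
      ε * c / (2 * (1 + k₁ * t ^ 2) * Real.sqrt (1 + k₂ * t ^ 2))) := by
    fun_prop
  have hint := intervalIntegral.integral_hasDerivAt_right
    (ContinuousOn.intervalIntegrable
      (fun t ht => (hcont t (hseg t ht)).continuousWithinAt))
    (hmeas.stronglyMeasurable.stronglyMeasurableAtFilter) (hcont s hs)
  have hA' : HasDerivAt (fun s : ℝ => 1 + k₁ * s ^ 2) (k₁ * (2 * s)) s := by
    simpa using ((hasDerivAt_pow 2 s).const_mul k₁).const_add 1
  have hB' : HasDerivAt (fun s : ℝ => 1 + k₂ * s ^ 2) (k₂ * (2 * s)) s := by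
    simpa using ((hasDerivAt_pow 2 s).const_mul k₂).const_add 1
  have hAB := mul_pos hs hB
  have hpow := (hA'.mul hB').rpow_const (p := (1 : ℝ) / 4) (Or.inl hAB.ne')
  have hd := hpow.mul hint.exp
  have hd2 := (hd.congr_of_eventuallyEq (f₁ := φ)
    (Filter.Eventually.of_forall fun x => by rw [hφ]; rfl)).deriv
  rw [hd2, hφ]
  simp only [Pi.mul_apply]
  rw [Real.rpow_sub_one hAB.ne']
  generalize Real.exp _ = E
  generalize ((1 + k₁ * s ^ 2) * (1 + k₂ * s ^ 2)) ^ ((1 : ℝ) / 4) = P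
  have hr := Real.sqrt_pos.2 hB
  have hr2 := Real.sq_sqrt hB.le
  generalize Real.sqrt (1 + k₂ * s ^ 2) = r at *
  have hk2 : k₂ * s ^ 2 = r ^ 2 - 1 := by linarith
  have hcs : (ε * c * s) ^ 2 = r ^ 2 - (1 + k₁ * s ^ 2) := by
    rw [mul_pow, mul_pow, hε2, hc2]; linarith
  rw [← hr2]
  have hA0 := hs.ne'
  have hr0 := hr.ne'
  have key : (1 + k₁ * s ^ 2) * r ^ 2
      - (k₁ * s ^ 2 * r ^ 2 + (1 + k₁ * s ^ 2) * (k₂ * s ^ 2)) / 2 - ε * c * s * r / 2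
      = (r - ε * c * s) * (r + ε * (c / 2) * s) := by
    rw [hk2]; linear_combination (1 / 2) * hcs
  rw [← key]
  clear key hcs hd2 hd hpow hint
  generalize 1 + k₁ * s ^ 2 = A at hA0 ⊢
  field_simp
  ring
end

section
/- Let k₁ < k₂ be real constants, b > 0 with 1 + k₁b² > 0, ε ∈ {1, −1}, c = √(k₂−k₁), and let φ(s) = ((1+k₁s²)(1+k₂s²))^{1/4}·exp(∫₀ˢ εc/(2(1+k₁t²)√(1+k₂t²)) dt). Then for every real s with |s| ≤ b, the inequality φ(s) − s·φ′(s) + (b² − s²)·φ″(s) > 0 holds if and only if f(s²)·√(1+k₂s²) + g(s) > 0, where f(t) = Ãt² + B̃t + C̃ with Ã = 2k₁k₂(k₁+k₂)b² + 3k₁² + 2k₂² − k₁k₂, B̃ = k₁(9k₂−k₁)b² + 3k₂ + 5k₁, C̃ = (3k₂+k₁)b² + 4, and g(s) = −4a₁(1+k₁b²)(1+k₂s²)²s with a₁ = εc/2. -/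
open Filter Topology in
lemma phi_hasDeriv (k₁ k₂ e s : ℝ) (hk : k₁ < k₂) (hP : 0 < 1 + k₁ * s ^ 2) :
    HasDerivAt (fun s : ℝ => ((1 + k₁ * s ^ 2) * (1 + k₂ * s ^ 2)) ^ ((1 : ℝ) / 4) *
      Real.exp (∫ t in (0 : ℝ)..s, e / (2 * (1 + k₁ * t ^ 2) * Real.sqrt (1 + k₂ * t ^ 2))))
      ((((1 + k₁ * s ^ 2) * (1 + k₂ * s ^ 2)) ^ ((1 : ℝ) / 4) *
      Real.exp (∫ t in (0 : ℝ)..s, e / (2 * (1 + k₁ * t ^ 2) * Real.sqrt (1 + k₂ * t ^ 2)))) *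
      (k₁ * s / (2 * (1 + k₁ * s ^ 2)) + k₂ * s / (2 * (1 + k₂ * s ^ 2)) +
        e / (2 * (1 + k₁ * s ^ 2) * Real.sqrt (1 + k₂ * s ^ 2)))) s := by
  have hQ : ∀ t : ℝ, 0 < 1 + k₁ * t ^ 2 → 0 < 1 + k₂ * t ^ 2 := by
    intro t ht
    nlinarith [mul_nonneg (sub_pos.2 hk).le (sq_nonneg t)]
  have hcont : ∀ t : ℝ, 0 < 1 + k₁ * t ^ 2 → ContinuousAt
      (fun t : ℝ => e / (2 * (1 + k₁ * t ^ 2) * Real.sqrt (1 + k₂ * t ^ 2))) t := by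
    intro t ht
    have h1 := Real.sqrt_pos.2 (hQ t ht)
    have h2 : 2 * (1 + k₁ * t ^ 2) * Real.sqrt (1 + k₂ * t ^ 2) ≠ 0 := by positivity
    fun_prop (disch := assumption)
  have hPt : ∀ t ∈ Set.uIcc 0 s, 0 < 1 + k₁ * t ^ 2 := by
    intro t ht
    have h1 : |t| ≤ |s| := by
      have := Set.abs_sub_left_of_mem_uIcc ht
      simpa using this
    have h2 : t ^ 2 ≤ s ^ 2 := sq_le_sq.2 h1
    rcases le_total 0 k₁ with h | h
    · positivity
    · nlinarith
  have hint : HasDerivAt (fun s : ℝ => ∫ t in (0 : ℝ)..s,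
      e / (2 * (1 + k₁ * t ^ 2) * Real.sqrt (1 + k₂ * t ^ 2)))
      (e / (2 * (1 + k₁ * s ^ 2) * Real.sqrt (1 + k₂ * s ^ 2))) s := by
    apply intervalIntegral.integral_hasDerivAt_right
    · apply ContinuousOn.intervalIntegrable
      intro t ht
      exact (hcont t (hPt t ht)).continuousWithinAt
    · apply MeasureTheory.StronglyMeasurable.stronglyMeasurableAtFilter
      apply Measurable.stronglyMeasurable
      fun_prop
    · exact hcont s hP
  have hQs := hQ s hP
  have hpoly : HasDerivAt (fun s : ℝ => (1 + k₁ * s ^ 2) * (1 + k₂ * s ^ 2))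
      ((2 * k₁ * s) * (1 + k₂ * s ^ 2) + (1 + k₁ * s ^ 2) * (2 * k₂ * s)) s := by
    have h (k : ℝ) : HasDerivAt (fun s : ℝ => 1 + k * s ^ 2) (2 * k * s) s := by
      have := ((hasDerivAt_pow 2 s).const_mul k).const_add 1
      refine this.congr_deriv ?_
      norm_num; ring
    exact (h k₁).mul (h k₂)
  have hpos : 0 < (1 + k₁ * s ^ 2) * (1 + k₂ * s ^ 2) := by positivity
  have hr := hpoly.rpow_const (p := (1:ℝ)/4) (Or.inl hpos.ne')
  have := hr.mul hint.exp
  refine this.congr_deriv ?_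
  rw [Real.rpow_sub_one hpos.ne']
  have h1 := Real.sqrt_pos.2 hQs
  generalize Real.sqrt (1 + k₂ * s ^ 2) = r at *
  generalize Real.exp _ = E
  generalize ((1 + k₁ * s ^ 2) * (1 + k₂ * s ^ 2)) ^ ((1 : ℝ) / 4) = W
  clear this hr hpoly hint
  generalize 1 + k₂ * s ^ 2 = Q at *
  generalize 1 + k₁ * s ^ 2 = P at *
  field_simp
  ring

lemma L_hasDeriv (k₁ k₂ e s : ℝ) (hP : 0 < 1 + k₁ * s ^ 2) (hQ : 0 < 1 + k₂ * s ^ 2) :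
    HasDerivAt (fun s : ℝ => k₁ * s / (2 * (1 + k₁ * s ^ 2)) + k₂ * s / (2 * (1 + k₂ * s ^ 2)) +
        e / (2 * (1 + k₁ * s ^ 2) * Real.sqrt (1 + k₂ * s ^ 2)))
      ((k₁ - k₁ ^ 2 * s ^ 2) / (2 * (1 + k₁ * s ^ 2) ^ 2) +
       (k₂ - k₂ ^ 2 * s ^ 2) / (2 * (1 + k₂ * s ^ 2) ^ 2) -
       e * (2 * k₁ * s * (1 + k₂ * s ^ 2) + k₂ * s * (1 + k₁ * s ^ 2)) /
        (2 * (1 + k₁ * s ^ 2) ^ 2 * (1 + k₂ * s ^ 2) * Real.sqrt (1 + k₂ * s ^ 2))) s := by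
  have h (k : ℝ) : HasDerivAt (fun s : ℝ => 1 + k * s ^ 2) (2 * k * s) s := by
    have := ((hasDerivAt_pow 2 s).const_mul k).const_add 1
    refine this.congr_deriv ?_
    norm_num; ring
  have hq (k : ℝ) (hk : 0 < 1 + k * s ^ 2) :
      HasDerivAt (fun s : ℝ => k * s / (2 * (1 + k * s ^ 2)))
      ((k - k ^ 2 * s ^ 2) / (2 * (1 + k * s ^ 2) ^ 2)) s := by
    have h2 : 2 * (1 + k * s ^ 2) ≠ 0 := by positivity
    have := ((hasDerivAt_id s).const_mul k).div ((h k).const_mul 2) h2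
    refine this.congr_deriv ?_
    simp only [id]
    field_simp
    ring
  have h1 := Real.sqrt_pos.2 hQ
  have h3 : 2 * (1 + k₁ * s ^ 2) * Real.sqrt (1 + k₂ * s ^ 2) ≠ 0 := by positivity
  have ht := (hasDerivAt_const s e).div (((h k₁).const_mul 2).mul ((h k₂).sqrt hQ.ne')) h3
  have := ((hq k₁ hP).add (hq k₂ hQ)).add ht
  refine this.congr_deriv ?_
  simp only [Pi.mul_apply]
  rw [sub_eq_add_neg]
  congr 1
  have hsq := Real.sq_sqrt hQ.le
  set r := Real.sqrt (1 + k₂ * s ^ 2)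
  rw [← hsq]
  field_simp
  ring


/-- With `k₁ < k₂`, `b > 0`, `1 + k₁b² > 0`, `ε ∈ {1, -1}`, `c = √(k₂-k₁)`
and `φ` as in (1.2), for every real `s` with `|s| ≤ b`, the third positive-definiteness
inequality `φ(s) - s·φ'(s) + (b² - s²)·φ''(s) > 0` holds iff `f(s²)·√(1+k₂s²) + g(s) > 0`,
where `f(t) = Ãt² + B̃t + C̃` and `g(s) = -4a₁(1+k₁b²)(1+k₂s²)²s` with `a₁ = εc/2`. -/
theorem stmt_3 (k₁ k₂ b ε c : ℝ) (hk : k₁ < k₂) (hb : 0 < b)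
    (hpd : 0 < 1 + k₁ * b ^ 2) (hε : ε = 1 ∨ ε = -1) (hc : c = Real.sqrt (k₂ - k₁))
    (φ : ℝ → ℝ)
    (hφ : φ = fun s : ℝ => ((1 + k₁ * s ^ 2) * (1 + k₂ * s ^ 2)) ^ ((1 : ℝ) / 4) *
      Real.exp (∫ t in (0 : ℝ)..s,
        ε * c / (2 * (1 + k₁ * t ^ 2) * Real.sqrt (1 + k₂ * t ^ 2))))
    (A B C a₁ : ℝ)
    (hA : A = 2 * k₁ * k₂ * (k₁ + k₂) * b ^ 2 + 3 * k₁ ^ 2 + 2 * k₂ ^ 2 - k₁ * k₂)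
    (hB : B = k₁ * (9 * k₂ - k₁) * b ^ 2 + 3 * k₂ + 5 * k₁)
    (hC : C = (3 * k₂ + k₁) * b ^ 2 + 4)
    (f : ℝ → ℝ) (hf : f = fun t : ℝ => A * t ^ 2 + B * t + C)
    (ha₁ : a₁ = ε * c / 2)
    (g : ℝ → ℝ) (hg : g = fun s : ℝ =>
      -4 * a₁ * (1 + k₁ * b ^ 2) * (1 + k₂ * s ^ 2) ^ 2 * s) :
    ∀ s : ℝ, |s| ≤ b →
      (0 < φ s - s * deriv φ s + (b ^ 2 - s ^ 2) * deriv (deriv φ) s ↔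
        0 < f (s ^ 2) * Real.sqrt (1 + k₂ * s ^ 2) + g s) := by
  intro s hs
  have hs2 : s ^ 2 ≤ b ^ 2 := sq_le_sq.2 (by rwa [abs_of_pos hb])
  have hP : 0 < 1 + k₁ * s ^ 2 := by
    rcases le_total 0 k₁ with h | h
    · positivity
    · nlinarith
  have hQ : 0 < 1 + k₂ * s ^ 2 := by
    nlinarith [mul_nonneg (sub_pos.2 hk).le (sq_nonneg s)]
  have hd : ∀ x : ℝ, 0 < 1 + k₁ * x ^ 2 → HasDerivAt φ (φ x *
      (k₁ * x / (2 * (1 + k₁ * x ^ 2)) + k₂ * x / (2 * (1 + k₂ * x ^ 2)) +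
        (ε * c) / (2 * (1 + k₁ * x ^ 2) * Real.sqrt (1 + k₂ * x ^ 2)))) x := by
    intro x hx
    rw [hφ]
    exact phi_hasDeriv k₁ k₂ (ε * c) x hk hx
  have hev : deriv φ =ᶠ[nhds s] fun x => φ x *
      (k₁ * x / (2 * (1 + k₁ * x ^ 2)) + k₂ * x / (2 * (1 + k₂ * x ^ 2)) +
        (ε * c) / (2 * (1 + k₁ * x ^ 2) * Real.sqrt (1 + k₂ * x ^ 2))) := by
    have hc1 : ContinuousAt (fun x : ℝ => 1 + k₁ * x ^ 2) s := by fun_prop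
    filter_upwards [hc1.eventually (lt_mem_nhds hP)] with x hx
    exact (hd x hx).deriv
  have h2 := ((hd s hP).mul (L_hasDeriv k₁ k₂ (ε * c) s hP hQ)).deriv
  have h2' : deriv (deriv φ) s = _ := hev.deriv_eq.trans h2
  have hφpos : 0 < φ s := by
    rw [hφ]
    have : 0 < (1 + k₁ * s ^ 2) * (1 + k₂ * s ^ 2) := by positivity
    positivity
  rw [h2', (hd s hP).deriv, hf, hg, ha₁, hA, hB, hC]
  have he : (ε * c) ^ 2 = k₂ - k₁ := by
    have : ε ^ 2 = 1 := by rcases hε with h | h <;> rw [h] <;> norm_num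
    rw [mul_pow, this, hc, Real.sq_sqrt (sub_pos.2 hk).le, one_mul]
  have hr := Real.sqrt_pos.2 hQ
  have hsq := Real.sq_sqrt hQ.le
  generalize ε * c = e at *
  generalize Real.sqrt (1 + k₂ * s ^ 2) = r at *
  generalize φ s = F at *
  have hD : 0 < F / (4 * (1 + k₁ * s ^ 2) ^ 2 * (1 + k₂ * s ^ 2) ^ 2 * r) := by positivity
  refine Iff.trans (iff_of_eq (congrArg _ ?_)) (mul_pos_iff_of_pos_left hD)
  clear h2 h2' hev hd hφ hD hf hg hA hB hC
  have hk2 : k₂ = k₁ + e ^ 2 := by linarith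
  beta_reduce
  generalize hQdef : 1 + k₂ * s ^ 2 = Q at *
  generalize hPdef : 1 + k₁ * s ^ 2 = P at *
  field_simp
  subst hQdef hPdef
  linear_combination 4 * (b ^ 2 - s ^ 2) * (1 + k₂ * s ^ 2) ^ 2 * he - 4 * (b ^ 2 - s ^ 2) * (1 + k₂ * s ^ 2) * (k₂ - k₁) * hsq
end

section
/- Let k₁ < k₂ be real constants and b > 0 with 1 + k₁b² > 0. Define f(t) = Ãt² + B̃t + C̃ where Ã = 2k₁k₂(k₁+k₂)b² + 3k₁² + 2k₂² − k₁k₂, B̃ = k₁(9k₂−k₁)b² + 3k₂ + 5k₁, C̃ = (3k₂+k₁)b² + 4. Then f(t) > 0 for all t ∈ [0, b²]. -/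
/-- Let `k₁ < k₂` and `b > 0` with `1 + k₁b² > 0`. The quadratic
`f(t) = Ãt² + B̃t + C̃` from the proof of Lemma 3.1 is strictly positive on `[0, b²]`. -/
theorem stmt_5 (k₁ k₂ b : ℝ) (hk : k₁ < k₂) (hb : 0 < b)
    (hpd : 0 < 1 + k₁ * b ^ 2)
    (A B C : ℝ)
    (hA : A = 2 * k₁ * k₂ * (k₁ + k₂) * b ^ 2 + 3 * k₁ ^ 2 + 2 * k₂ ^ 2 - k₁ * k₂)
    (hB : B = k₁ * (9 * k₂ - k₁) * b ^ 2 + 3 * k₂ + 5 * k₁)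
    (hC : C = (3 * k₂ + k₁) * b ^ 2 + 4)
    (f : ℝ → ℝ) (hf : f = fun t : ℝ => A * t ^ 2 + B * t + C) :
    ∀ t ∈ Set.Icc (0 : ℝ) (b ^ 2), 0 < f t := by
  rintro t ⟨ht0, ht1⟩
  have hu : 0 < b ^ 2 := by positivity
  subst hf hA hB hC
  generalize b ^ 2 = u at *
  obtain ⟨p, hp⟩ : ∃ p, p = 1 + k₁ * u := ⟨_, rfl⟩
  obtain ⟨q, hq⟩ : ∃ q, q = 1 + k₂ * u := ⟨_, rfl⟩
  have hp0 : 0 < p := hp ▸ hpd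
  have hpq : p < q := by
    have := mul_lt_mul_of_pos_right hk hu
    linarith
  have hq0 : 0 < q := hp0.trans hpq
  have hv : 0 ≤ u - t := by linarith
  have h9 : 0 < 9 * q - p := by linarith
  have key : 0 < (3 * q + p) * (u - t) ^ 2 + p * (9 * q - p) * (t * (u - t))
      + 2 * p * q * (p + q) * t ^ 2 := by
    rcases ht0.eq_or_lt with h | h
    · subst h
      simp only [sub_zero]
      positivity
    · positivity
  have hu2 : 0 < u ^ 2 := by positivity
  refine pos_of_mul_pos_right (a := u ^ 2) ?_ hu2.le
  refine key.trans_eq ?_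
  subst hp hq
  ring
end

section
/- Let k₁ < k₂ be real constants and b > 0 with 1 + k₁b² > 0. Define h(t) = Ât² + B̂t + Ĉ where Â = 4k₁k₂²(3k₂+k₁)b⁴ + 4k₂(3k₂² + 3k₁² + 2k₁k₂)b² − 6k₁k₂ + 9k₁² + 13k₂², B̂ = 4k₁k₂(9k₂−k₁)b⁴ + 2(9k₂−k₁)(3k₁+k₂)b² + 12k₁ + 20k₂, Ĉ = (4 + k₁b² + 3k₂b²)². Then h(t) > 0 for all t ∈ [0, b²]. -/
/-- Let `k₁ < k₂` and `b > 0` with `1 + k₁b² > 0`. The quadratic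
`h(t) = Ât² + B̂t + Ĉ` from the proof of Lemma 3.1 is strictly positive on `[0, b²]`. -/
theorem stmt_6 (k₁ k₂ b : ℝ) (hk : k₁ < k₂) (hb : 0 < b)
    (hpd : 0 < 1 + k₁ * b ^ 2)
    (A B C : ℝ)
    (hA : A = 4 * k₁ * k₂ ^ 2 * (3 * k₂ + k₁) * b ^ 4 +
      4 * k₂ * (3 * k₂ ^ 2 + 3 * k₁ ^ 2 + 2 * k₁ * k₂) * b ^ 2 -
      6 * k₁ * k₂ + 9 * k₁ ^ 2 + 13 * k₂ ^ 2)
    (hB : B = 4 * k₁ * k₂ * (9 * k₂ - k₁) * b ^ 4 +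
      2 * (9 * k₂ - k₁) * (3 * k₁ + k₂) * b ^ 2 + 12 * k₁ + 20 * k₂)
    (hC : C = (4 + k₁ * b ^ 2 + 3 * k₂ * b ^ 2) ^ 2)
    (h : ℝ → ℝ) (hh : h = fun t : ℝ => A * t ^ 2 + B * t + C) :
    ∀ t ∈ Set.Icc (0 : ℝ) (b ^ 2), 0 < h t := by
  rintro t ⟨ht0, ht1⟩
  subst hh
  have hb2 : 0 < b ^ 2 := by positivity
  obtain ⟨u, rfl⟩ : ∃ u, t = u * b ^ 2 := ⟨t / b ^ 2, by field_simp⟩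
  have hu0 : 0 ≤ u := by
    by_contra hc
    nlinarith
  have hu1 : u ≤ 1 := by
    by_contra hc
    nlinarith
  obtain ⟨p, hp⟩ : ∃ p, p = 1 + k₁ * b ^ 2 := ⟨_, rfl⟩
  obtain ⟨r, hr⟩ : ∃ r, r = 1 + k₂ * b ^ 2 := ⟨_, rfl⟩
  have hp0 : 0 < p := by rw [hp]; exact hpd
  have hpr : p < r := by rw [hp, hr]; nlinarith
  have hr0 : 0 < r := hp0.trans hpr
  have key : A * (u * b ^ 2) ^ 2 + B * (u * b ^ 2) + C =
      (p + 3 * r) ^ 2 * (1 - u) ^ 2 + 4 * p * r * (9 * r - p) * (u * (1 - u)) +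
      (12 * p * r ^ 3 + 4 * p ^ 2 * r ^ 2) * u ^ 2 := by
    rw [hA, hB, hC, hp, hr]; ring
  show 0 < A * (u * b ^ 2) ^ 2 + B * (u * b ^ 2) + C
  rw [key]
  have h9 : 0 < 9 * r - p := by linarith
  have hv : 0 ≤ 1 - u := by linarith
  have h2 : 0 ≤ 4 * p * r * (9 * r - p) * (u * (1 - u)) := by positivity
  rcases hu0.eq_or_lt with h0 | h0
  · subst h0
    have : 0 < (p + 3 * r) ^ 2 := by positivity
    nlinarith
  · have h3 : 0 < (12 * p * r ^ 3 + 4 * p ^ 2 * r ^ 2) * u ^ 2 := by positivity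
    have h1 : 0 ≤ (p + 3 * r) ^ 2 * (1 - u) ^ 2 := by positivity
    linarith
end

section
/- Let k₁ < k₂ be real constants, b > 0 with 1 + k₁b² > 0, and let a₁ be a real number with a₁ = √(k₂−k₁)/2 or a₁ = −√(k₂−k₁)/2. Define f(t) = Ãt² + B̃t + C̃ where Ã = 2k₁k₂(k₁+k₂)b² + 3k₁² + 2k₂² − k₁k₂, B̃ = k₁(9k₂−k₁)b² + 3k₂ + 5k₁, C̃ = (3k₂+k₁)b² + 4, and g(s) = −4a₁(1+k₁b²)(1+k₂s²)²s. Then f(s²)·√(1+k₂s²) + g(s) > 0 for all real s with |s| ≤ b. -/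
/-- inequality (3.2) of the paper. Let `k₁ < k₂`, `b > 0` with
`1 + k₁b² > 0` and `a₁ = ±√(k₂-k₁)/2`. With `f(t) = Ãt² + B̃t + C̃` and
`g(s) = -4a₁(1+k₁b²)(1+k₂s²)²s`, one has `f(s²)·√(1+k₂s²) + g(s) > 0` for all `|s| ≤ b`. -/
theorem stmt_7 (k₁ k₂ b a₁ : ℝ) (hk : k₁ < k₂) (hb : 0 < b)
    (hpd : 0 < 1 + k₁ * b ^ 2)
    (ha₁ : a₁ = Real.sqrt (k₂ - k₁) / 2 ∨ a₁ = -(Real.sqrt (k₂ - k₁) / 2))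
    (A B C : ℝ)
    (hA : A = 2 * k₁ * k₂ * (k₁ + k₂) * b ^ 2 + 3 * k₁ ^ 2 + 2 * k₂ ^ 2 - k₁ * k₂)
    (hB : B = k₁ * (9 * k₂ - k₁) * b ^ 2 + 3 * k₂ + 5 * k₁)
    (hC : C = (3 * k₂ + k₁) * b ^ 2 + 4)
    (f : ℝ → ℝ) (hf : f = fun t : ℝ => A * t ^ 2 + B * t + C)
    (g : ℝ → ℝ) (hg : g = fun s : ℝ =>
      -4 * a₁ * (1 + k₁ * b ^ 2) * (1 + k₂ * s ^ 2) ^ 2 * s) :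
    ∀ s : ℝ, |s| ≤ b → 0 < f (s ^ 2) * Real.sqrt (1 + k₂ * s ^ 2) + g s := by
  intro s hs
  have hs2 : s ^ 2 ≤ b ^ 2 := sq_le_sq' (by linarith [neg_abs_le s]) (by linarith [le_abs_self s])
  have hP : 0 < 1 + k₁ * s ^ 2 := by
    rcases le_total 0 k₁ with h | h
    · positivity
    · nlinarith [mul_le_mul_of_nonpos_left hs2 h]
  have hQ : 0 < 1 + k₂ * s ^ 2 := by nlinarith [sq_nonneg s]
  have hY : 0 < 1 + k₂ * b ^ 2 := by nlinarith [sq_nonneg b]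
  have ha : 4 * a₁ ^ 2 = k₂ - k₁ := by
    have h := Real.sq_sqrt (sub_nonneg.2 hk.le)
    rcases ha₁ with rfl | rfl <;> linarith
  have hr : 0 < Real.sqrt (1 + k₂ * s ^ 2) := Real.sqrt_pos.2 hQ
  have hr2 := Real.sq_sqrt hQ.le
  set r := Real.sqrt (1 + k₂ * s ^ 2) with hrdef
  have e1 : f (s ^ 2) = (1 + k₁ * b ^ 2) * (1 + k₂ * s ^ 2) *
      (2 * (1 + k₂ * s ^ 2) - (1 + k₁ * s ^ 2))
      + 3 * (1 + k₁ * s ^ 2) ^ 2 * (1 + k₂ * b ^ 2) := by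
    rw [hf, hA, hB, hC]; ring
  have e2 : g s = -(4 * a₁ * (1 + k₁ * b ^ 2) * (1 + k₂ * s ^ 2) * r ^ 2 * s) := by
    rw [hg, hr2]; ring
  have e3 : 2 * (1 + k₂ * s ^ 2) - (1 + k₁ * s ^ 2) = (r - 2 * a₁ * s) ^ 2 + 4 * a₁ * s * r := by
    linear_combination -hr2 - s ^ 2 * ha
  have e4 : f (s ^ 2) * r + g s = r * ((1 + k₁ * b ^ 2) * (1 + k₂ * s ^ 2) * (r - 2 * a₁ * s) ^ 2
      + 3 * (1 + k₁ * s ^ 2) ^ 2 * (1 + k₂ * b ^ 2)) := by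
    rw [e1, e2, e3]; ring
  rw [e4]
  have h1 : 0 ≤ (1 + k₁ * b ^ 2) * (1 + k₂ * s ^ 2) * (r - 2 * a₁ * s) ^ 2 :=
    mul_nonneg (mul_pos hpd hQ).le (sq_nonneg _)
  have h2 : 0 < 3 * (1 + k₁ * s ^ 2) ^ 2 * (1 + k₂ * b ^ 2) :=
    mul_pos (mul_pos three_pos (pow_pos hP 2)) hY
  exact mul_pos hr (by linarith)
end

section
/- Let V be a two-dimensional real inner product space and let A : V → V be a skew-adjoint linear map, i.e. ⟨Ax, y⟩ = −⟨x, Ay⟩ for all x, y ∈ V. Then there exists a real number θ ≥ 0 such that ‖Ay‖² = θ‖y‖² for all y ∈ V, and for every b ∈ V and all y ∈ V, ⟨Ab, y⟩² = θ·(‖b‖²‖y‖² − ⟨b, y⟩²). -/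
open RealInnerProductSpace

/-- pointwise content of Lemma 3.3. Let `V` be a two-dimensional real
inner product space and `A : V → V` a skew-adjoint linear map. Then there is `θ ≥ 0` with
`‖Ay‖² = θ‖y‖²` for all `y`, and `⟪Ab, y⟫² = θ(‖b‖²‖y‖² - ⟪b, y⟫²)` for all `b, y`. -/
theorem stmt_8 (V : Type*) [NormedAddCommGroup V] [InnerProductSpace ℝ V]
    (hdim : Module.finrank ℝ V = 2) (A : V →ₗ[ℝ] V)
    (hA : ∀ x y : V, ⟪A x, y⟫ = -⟪x, A y⟫) :
    ∃ θ : ℝ, 0 ≤ θ ∧ (∀ y : V, ‖A y‖ ^ 2 = θ * ‖y‖ ^ 2) ∧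
      ∀ b y : V, ⟪A b, y⟫ ^ 2 = θ * (‖b‖ ^ 2 * ‖y‖ ^ 2 - ⟪b, y⟫ ^ 2) := by
  haveI : FiniteDimensional ℝ V := Module.finite_of_finrank_pos (by omega)
  let e : OrthonormalBasis (Fin 2) ℝ V := (stdOrthonormalBasis ℝ V).reindex (finCongr hdim)
  have hin : ∀ x y : V, ⟪x, y⟫ = ⟪x, e 0⟫ * ⟪y, e 0⟫ + ⟪x, e 1⟫ * ⟪y, e 1⟫ := by
    intro x y
    rw [← e.sum_inner_mul_inner x y, Fin.sum_univ_two, real_inner_comm y (e 0),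
      real_inner_comm y (e 1)]
  have h00 : ⟪A (e 0), e 0⟫ = 0 := by
    have h := hA (e 0) (e 0)
    rw [real_inner_comm (A (e 0)) (e 0)] at h
    linarith
  have h11 : ⟪A (e 1), e 1⟫ = 0 := by
    have h := hA (e 1) (e 1)
    rw [real_inner_comm (A (e 1)) (e 1)] at h
    linarith
  have h10 : ⟪A (e 1), e 0⟫ = -⟪A (e 0), e 1⟫ := by
    rw [hA (e 1) (e 0), real_inner_comm]
  have a0 : ∀ y, ⟪A y, e 0⟫ = -(⟪A (e 0), e 1⟫ * ⟪y, e 1⟫) := by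
    intro y
    rw [hA y (e 0), hin y (A (e 0)), h00]; ring
  have a1 : ∀ y, ⟪A y, e 1⟫ = ⟪A (e 0), e 1⟫ * ⟪y, e 0⟫ := by
    intro y
    rw [hA y (e 1), hin y (A (e 1)), h11, h10]; ring
  refine ⟨⟪A (e 0), e 1⟫ ^ 2, sq_nonneg _, fun y => ?_, fun b y => ?_⟩
  · rw [← real_inner_self_eq_norm_sq, ← real_inner_self_eq_norm_sq, hin (A y) (A y), hin y y,
      a0 y, a1 y]
    ring
  · rw [← real_inner_self_eq_norm_sq, ← real_inner_self_eq_norm_sq, hin (A b) y, hin b b,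
      hin y y, hin b y, a0 b, a1 b]
    ring
end

section
/- Let V be a two-dimensional real inner product space, let A : V → V be a skew-adjoint linear map (⟨Ax, y⟩ = −⟨x, Ay⟩ for all x, y), and let b ∈ V. Then for all y ∈ V, ‖b‖⁴·‖Ay‖² = ‖Ab‖²·⟨b, y⟩² + ‖b‖²·⟨Ab, y⟩². -/
open RealInnerProductSpace

/-- pointwise content of identity (3.17). Let `V` be a two-dimensional
real inner product space, `A : V → V` skew-adjoint, and `b ∈ V`. Then
`‖b‖⁴·‖Ay‖² = ‖Ab‖²·⟪b,y⟫² + ‖b‖²·⟪Ab,y⟫²` for all `y ∈ V`. -/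
theorem stmt_10 (V : Type*) [NormedAddCommGroup V] [InnerProductSpace ℝ V]
    (hdim : Module.finrank ℝ V = 2) (A : V →ₗ[ℝ] V)
    (hA : ∀ x y : V, ⟪A x, y⟫ = -⟪x, A y⟫) (b : V) :
    ∀ y : V, ‖b‖ ^ 4 * ‖A y‖ ^ 2 =
      ‖A b‖ ^ 2 * ⟪b, y⟫ ^ 2 + ‖b‖ ^ 2 * ⟪A b, y⟫ ^ 2 := by
  intro y
  haveI : FiniteDimensional ℝ V := Module.finite_of_finrank_eq_succ hdim
  let e : OrthonormalBasis (Fin 2) ℝ V :=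
    (stdOrthonormalBasis ℝ V).reindex (finCongr hdim)
  have h00 : ⟪e 0, A (e 0)⟫ = 0 := by
    have := hA (e 0) (e 0)
    rw [real_inner_comm] at this
    linarith
  have h11 : ⟪e 1, A (e 1)⟫ = 0 := by
    have := hA (e 1) (e 1)
    rw [real_inner_comm] at this
    linarith
  have h01 : ⟪e 0, A (e 1)⟫ = -⟪e 1, A (e 0)⟫ := by
    have := hA (e 0) (e 1)
    rw [real_inner_comm] at this
    linarith
  have hin : ∀ u v : V, ⟪u, v⟫ = ⟪e 0, u⟫ * ⟪e 0, v⟫ + ⟪e 1, u⟫ * ⟪e 1, v⟫ := by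
    intro u v
    rw [← e.sum_inner_mul_inner u v, Fin.sum_univ_two,
      real_inner_comm u (e 0), real_inner_comm u (e 1)]
  have hA0 : ∀ u : V, ⟪e 0, A u⟫ = -(⟪e 1, A (e 0)⟫ * ⟪e 1, u⟫) := by
    intro u
    have h1 := hA (e 0) u
    rw [hin (A (e 0)) u, h00] at h1
    linarith
  have hA1 : ∀ u : V, ⟪e 1, A u⟫ = ⟪e 1, A (e 0)⟫ * ⟪e 0, u⟫ := by
    intro u
    have h1 := hA (e 1) u
    rw [hin (A (e 1)) u, h11, h01] at h1
    linarith
  have h4 : ‖b‖ ^ 4 = (‖b‖ ^ 2) ^ 2 := by ring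
  rw [h4, ← real_inner_self_eq_norm_sq, ← real_inner_self_eq_norm_sq,
    ← real_inner_self_eq_norm_sq, hin b b, hin (A y) (A y), hin (A b) (A b), hin b y,
    hin (A b) y, hA0 y, hA1 y, hA0 b, hA1 b]
  ring
end

section
/- Let k₁, k₂ be real constants and Ω ⊆ ℝ² open. Let u, v, B : Ω → ℝ be differentiable with B > 0, u² + v² > 0, 1 + k₁B > 0 and 1 + k₂B > 0 on Ω, and suppose u and v satisfy the Cauchy–Riemann equations ∂u/∂x¹ = ∂v/∂x², ∂u/∂x² = −∂v/∂x¹. Define σ = ln( √B / ( √(u²+v²)·(1+k₁B)^{3/4}·(1+k₂B)^{1/4} ) ). Then at every point of Ω, ∂u/∂x¹ + u·∂σ/∂x¹ + v·∂σ/∂x² = [2(1 − k₁k₂B²) + (k₂ − k₁)B] / (4B(1+k₁B)(1+k₂B)) · (u·∂B/∂x¹ + v·∂B/∂x²). -/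
/-- computation underlying equation (3.13). On an open `Ω ⊆ ℝ²`, with
differentiable `u, v, B` satisfying `B > 0`, `u² + v² > 0`, `1 + k₁B > 0`, `1 + k₂B > 0`
and the Cauchy–Riemann equations `u₁ = v₂`, `u₂ = -v₁`, and with
`σ = ln(√B/(√(u²+v²)(1+k₁B)^{3/4}(1+k₂B)^{1/4}))`, one has at every point of `Ω`:
`u₁ + uσ₁ + vσ₂ = [2(1-k₁k₂B²)+(k₂-k₁)B]/(4B(1+k₁B)(1+k₂B)) · (uB₁ + vB₂)`. -/
theorem stmt_11 (k₁ k₂ : ℝ) (Ω : Set (ℝ × ℝ)) (hΩ : IsOpen Ω)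
    (u v B : ℝ × ℝ → ℝ)
    (hu : ∀ x ∈ Ω, DifferentiableAt ℝ u x)
    (hv : ∀ x ∈ Ω, DifferentiableAt ℝ v x)
    (hB : ∀ x ∈ Ω, DifferentiableAt ℝ B x)
    (hBpos : ∀ x ∈ Ω, 0 < B x)
    (huv : ∀ x ∈ Ω, 0 < u x ^ 2 + v x ^ 2)
    (hk₁ : ∀ x ∈ Ω, 0 < 1 + k₁ * B x)
    (hk₂ : ∀ x ∈ Ω, 0 < 1 + k₂ * B x)
    (hCR₁ : ∀ x ∈ Ω, fderiv ℝ u x (1, 0) = fderiv ℝ v x (0, 1))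
    (hCR₂ : ∀ x ∈ Ω, fderiv ℝ u x (0, 1) = -fderiv ℝ v x (1, 0))
    (σ : ℝ × ℝ → ℝ)
    (hσ : σ = fun x => Real.log (Real.sqrt (B x) /
      (Real.sqrt (u x ^ 2 + v x ^ 2) * (1 + k₁ * B x) ^ ((3 : ℝ) / 4) *
        (1 + k₂ * B x) ^ ((1 : ℝ) / 4)))) :
    ∀ x ∈ Ω,
      fderiv ℝ u x (1, 0) + u x * fderiv ℝ σ x (1, 0) + v x * fderiv ℝ σ x (0, 1) =
        (2 * (1 - k₁ * k₂ * B x ^ 2) + (k₂ - k₁) * B x) /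
            (4 * B x * (1 + k₁ * B x) * (1 + k₂ * B x)) *
          (u x * fderiv ℝ B x (1, 0) + v x * fderiv ℝ B x (0, 1)) := by
  intro x hx
  have hev : σ =ᶠ[nhds x] fun y => (1/2 : ℝ) * Real.log (B y)
      - (1/2 : ℝ) * Real.log (u y ^ 2 + v y ^ 2)
      - (3/4 : ℝ) * Real.log (1 + k₁ * B y) - (1/4 : ℝ) * Real.log (1 + k₂ * B y) := by
    filter_upwards [hΩ.mem_nhds hx] with y hy
    have h1 := hBpos y hy
    have h2 := huv y hy
    have h3 := hk₁ y hy
    have h4 := hk₂ y hy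
    have s1 := (Real.sqrt_pos.mpr h1).ne'
    have s2 := (Real.sqrt_pos.mpr h2).ne'
    have s3 := (Real.rpow_pos_of_pos h3 ((3 : ℝ) / 4)).ne'
    have s4 := (Real.rpow_pos_of_pos h4 ((1 : ℝ) / 4)).ne'
    rw [hσ]
    simp only []
    rw [Real.log_div s1 (mul_ne_zero (mul_ne_zero s2 s3) s4),
      Real.log_mul (mul_ne_zero s2 s3) s4, Real.log_mul s2 s3,
      Real.log_sqrt h1.le, Real.log_sqrt h2.le, Real.log_rpow h3, Real.log_rpow h4]
    ring
  have h1 := hBpos x hx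
  have h2 := huv x hx
  have h3 := hk₁ x hx
  have h4 := hk₂ x hx
  have dB := (hB x hx).hasFDerivAt
  have du := (hu x hx).hasFDerivAt
  have dv := (hv x hx).hasFDerivAt
  have D := (((((dB.log h1.ne').const_mul (1/2 : ℝ)).sub
    ((((du.pow 2).add (dv.pow 2)).log h2.ne').const_mul (1/2 : ℝ))).sub
    ((((dB.const_mul k₁).const_add 1).log h3.ne').const_mul (3/4 : ℝ))).sub
    ((((dB.const_mul k₂).const_add 1).log h4.ne').const_mul (1/4 : ℝ)))
  have E := (D.congr_of_eventuallyEq hev).fderiv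
  rw [E]
  have c1 := hCR₁ x hx
  have c2 := hCR₂ x hx
  simp only [sub_apply, add_apply,
    smul_apply, smul_eq_mul, c1, c2, Pi.add_apply]
  generalize fderiv ℝ v x (0, 1) = p
  generalize fderiv ℝ v x (1, 0) = q
  generalize fderiv ℝ B x (0, 1) = r
  generalize fderiv ℝ B x (1, 0) = s
  generalize B x = b at *
  generalize u x = U at *
  generalize v x = V at *
  have n1 := h1.ne'
  have n2 := h2.ne'
  have n3 := h3.ne'
  have n4 := h4.ne'
  clear D E
  have m3 : 1 + b * k₁ ≠ 0 := by rwa [mul_comm]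
  have m4 : 1 + b * k₂ ≠ 0 := by rwa [mul_comm]
  field_simp
  push_cast
  ring
end

section
/- Let k₁, k₂ be real constants and Ω ⊆ ℝ² open. Let u, v, B : Ω → ℝ be differentiable with B > 0, u² + v² > 0, 1 + k₁B > 0 and 1 + k₂B > 0 on Ω, and suppose ∂u/∂x¹ = ∂v/∂x², ∂u/∂x² = −∂v/∂x¹. Define σ = ln( √B / ( √(u²+v²)·(1+k₁B)^{3/4}·(1+k₂B)^{1/4} ) ), ξ = u√B/√(u²+v²) and η = v√B/√(u²+v²). Then at every point of Ω, (ξ² + η²)·(∂ξ/∂x² + ξ·∂σ/∂x² − η·∂σ/∂x¹ − ∂η/∂x¹)² / (4e^{2σ}) = [4 + (k₁+3k₂)B]²·(u·∂B/∂x² − v·∂B/∂x¹)² / ( 64B·√(1+k₁B)·(1+k₂B)^{3/2} ). -/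
/-- equation (3.26) of the paper. On an open `Ω ⊆ ℝ²`, with
differentiable `u, v, B` satisfying the positivity conditions and the Cauchy–Riemann
equations, and with `σ`, `ξ = u√B/√(u²+v²)`, `η = v√B/√(u²+v²)` as displayed, one has at
every point of `Ω`:
`(ξ²+η²)(ξ₂+ξσ₂-ησ₁-η₁)²/(4e^{2σ}) = [4+(k₁+3k₂)B]²(uB₂-vB₁)²/(64B√(1+k₁B)(1+k₂B)^{3/2})`. -/
theorem stmt_12 (k₁ k₂ : ℝ) (Ω : Set (ℝ × ℝ)) (hΩ : IsOpen Ω)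
    (u v B : ℝ × ℝ → ℝ)
    (hu : ∀ x ∈ Ω, DifferentiableAt ℝ u x)
    (hv : ∀ x ∈ Ω, DifferentiableAt ℝ v x)
    (hB : ∀ x ∈ Ω, DifferentiableAt ℝ B x)
    (hBpos : ∀ x ∈ Ω, 0 < B x)
    (huv : ∀ x ∈ Ω, 0 < u x ^ 2 + v x ^ 2)
    (hk₁ : ∀ x ∈ Ω, 0 < 1 + k₁ * B x)
    (hk₂ : ∀ x ∈ Ω, 0 < 1 + k₂ * B x)
    (hCR₁ : ∀ x ∈ Ω, fderiv ℝ u x (1, 0) = fderiv ℝ v x (0, 1))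
    (hCR₂ : ∀ x ∈ Ω, fderiv ℝ u x (0, 1) = -fderiv ℝ v x (1, 0))
    (σ ξ η : ℝ × ℝ → ℝ)
    (hσ : σ = fun x => Real.log (Real.sqrt (B x) /
      (Real.sqrt (u x ^ 2 + v x ^ 2) * (1 + k₁ * B x) ^ ((3 : ℝ) / 4) *
        (1 + k₂ * B x) ^ ((1 : ℝ) / 4))))
    (hξ : ξ = fun x => u x * Real.sqrt (B x) / Real.sqrt (u x ^ 2 + v x ^ 2))
    (hη : η = fun x => v x * Real.sqrt (B x) / Real.sqrt (u x ^ 2 + v x ^ 2)) :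
    ∀ x ∈ Ω,
      (ξ x ^ 2 + η x ^ 2) *
          (fderiv ℝ ξ x (0, 1) + ξ x * fderiv ℝ σ x (0, 1) -
            η x * fderiv ℝ σ x (1, 0) - fderiv ℝ η x (1, 0)) ^ 2 /
        (4 * Real.exp (2 * σ x)) =
      (4 + (k₁ + 3 * k₂) * B x) ^ 2 *
          (u x * fderiv ℝ B x (0, 1) - v x * fderiv ℝ B x (1, 0)) ^ 2 /
        (64 * B x * Real.sqrt (1 + k₁ * B x) * (1 + k₂ * B x) ^ ((3 : ℝ) / 2)) := by
  intro x hx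
  have hnhds : Ω ∈ nhds x := hΩ.mem_nhds hx
  have hsqrt : ∀ y : ℝ, 0 < y → Real.sqrt y = Real.exp (1 / 2 * Real.log y) := by
    intro y hy
    rw [Real.sqrt_eq_rpow, Real.rpow_def_of_pos hy, mul_comm]
  set τ : ℝ × ℝ → ℝ := fun y =>
    1 / 2 * Real.log (B y) - 1 / 2 * Real.log (u y ^ 2 + v y ^ 2) with hτ
  have eξ : ∀ y ∈ Ω, ξ y = u y * Real.exp (τ y) := by
    intro y hy
    simp only [hξ, hτ]
    rw [hsqrt _ (hBpos y hy), hsqrt _ (huv y hy), Real.exp_sub, mul_div_assoc]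
  have eη : ∀ y ∈ Ω, η y = v y * Real.exp (τ y) := by
    intro y hy
    simp only [hη, hτ]
    rw [hsqrt _ (hBpos y hy), hsqrt _ (huv y hy), Real.exp_sub, mul_div_assoc]
  have eσ : ∀ y ∈ Ω, σ y = τ y - 3 / 4 * Real.log (1 + k₁ * B y)
      - 1 / 4 * Real.log (1 + k₂ * B y) := by
    intro y hy
    simp only [hσ, hτ]
    rw [hsqrt _ (hBpos y hy), hsqrt _ (huv y hy), Real.rpow_def_of_pos (hk₁ y hy),
      Real.rpow_def_of_pos (hk₂ y hy), ← Real.exp_add, ← Real.exp_add, ← Real.exp_sub,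
      Real.log_exp]
    ring
  have dB := (hB x hx).hasFDerivAt
  have du := (hu x hx).hasFDerivAt
  have dv := (hv x hx).hasFDerivAt
  have p0 := hBpos x hx
  have pW := huv x hx
  have p1 := hk₁ x hx
  have p2 := hk₂ x hx
  have dW := (du.pow 2).add (dv.pow 2)
  have dτ := ((dB.log p0.ne').const_mul (1 / 2)).sub ((dW.log pW.ne').const_mul (1 / 2))
  have d1 := (((dB.const_mul k₁).const_add 1).log p1.ne').const_mul (3 / 4)
  have d2 := (((dB.const_mul k₂).const_add 1).log p2.ne').const_mul (1 / 4)
  have dσ := ((dτ.sub d1).sub d2).congr_of_eventuallyEq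
    (Filter.eventually_of_mem hnhds eσ : σ =ᶠ[nhds x] _)
  have dξ := (du.mul dτ.exp).congr_of_eventuallyEq
    (Filter.eventually_of_mem hnhds eξ : ξ =ᶠ[nhds x] _)
  have dη := (dv.mul dτ.exp).congr_of_eventuallyEq
    (Filter.eventually_of_mem hnhds eη : η =ᶠ[nhds x] _)
  have c1 := hCR₁ x hx
  have c2 := hCR₂ x hx
  have hE : Real.exp (τ x) ^ 2 = B x / (u x ^ 2 + v x ^ 2) := by
    rw [← Real.exp_nat_mul]
    have : ((2 : ℕ) : ℝ) * τ x = Real.log (B x) - Real.log (u x ^ 2 + v x ^ 2) := by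
      simp only [hτ]; push_cast; ring
    rw [this, Real.exp_sub, Real.exp_log p0, Real.exp_log pW]
  have key : fderiv ℝ ξ x (0, 1) + ξ x * fderiv ℝ σ x (0, 1) -
            η x * fderiv ℝ σ x (1, 0) - fderiv ℝ η x (1, 0)
      = Real.exp (τ x) * ((u x * fderiv ℝ B x (0, 1) - v x * fderiv ℝ B x (1, 0)) *
        (4 + (k₁ + 3 * k₂) * B x) / (4 * B x * (1 + k₁ * B x) * (1 + k₂ * B x))) := by
    rw [dξ.fderiv, dσ.fderiv, dη.fderiv, eξ x hx, eη x hx]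
    change _ = Real.exp (τ x) * _
    simp only [add_apply, sub_apply,
      smul_apply, smul_eq_mul, Pi.add_apply, Pi.sub_apply, Pi.pow_apply]
    rw [c1, c2]
    have hT : Real.exp (1 / 2 * Real.log (B x) - 1 / 2 * Real.log (u x ^ 2 + v x ^ 2))
      = Real.exp (τ x) := rfl
    simp only [hT]
    generalize Real.exp (τ x) = T
    generalize fderiv ℝ v x (0, 1) = v2
    generalize fderiv ℝ v x (1, 0) = v1
    generalize fderiv ℝ B x (0, 1) = B2
    generalize fderiv ℝ B x (1, 0) = B1
    have q0 := p0.ne'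
    have qW := pW.ne'
    have q1 := p1.ne'
    have q2 := p2.ne'
    have q3 : 1 + B x * k₁ ≠ 0 := by rw [mul_comm]; exact q1
    have q4 : 1 + B x * k₂ ≠ 0 := by rw [mul_comm]; exact q2
    field_simp
    ring
  have hS : Real.exp (2 * σ x) = B x / (u x ^ 2 + v x ^ 2) /
      ((1 + k₁ * B x) * Real.sqrt (1 + k₁ * B x) * Real.sqrt (1 + k₂ * B x)) := by
    have : 2 * σ x = (2 : ℕ) * τ x - (Real.log (1 + k₁ * B x) +
      1 / 2 * Real.log (1 + k₁ * B x) + 1 / 2 * Real.log (1 + k₂ * B x)) := by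
      rw [eσ x hx]; push_cast; ring
    rw [this, Real.exp_sub, Real.exp_nat_mul, hE, Real.exp_add, Real.exp_add, Real.exp_log p1,
      ← hsqrt _ p1, ← hsqrt _ p2]
  have hQ : (1 + k₂ * B x) ^ ((3 : ℝ) / 2) = (1 + k₂ * B x) * Real.sqrt (1 + k₂ * B x) := by
    rw [show (3 : ℝ) / 2 = 1 + 1 / 2 by norm_num, Real.rpow_add p2, Real.rpow_one,
      ← Real.sqrt_eq_rpow]
  have hξη : ξ x ^ 2 + η x ^ 2 = B x := by
    rw [eξ x hx, eη x hx, mul_pow, mul_pow, hE]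
    field_simp
  rw [key, hS, hQ, hξη, mul_pow, hE]
  have s1 := Real.sq_sqrt p1.le
  have s2 := Real.sq_sqrt p2.le
  have r1 := Real.sqrt_pos.2 p1
  have r2 := Real.sqrt_pos.2 p2
  generalize Real.sqrt (1 + k₁ * B x) = a at *
  generalize Real.sqrt (1 + k₂ * B x) = b at *
  rw [← s1, ← s2]
  field_simp
  try ring
end

section
/- Let k₁, k₂ be real constants and Ω ⊆ ℝ² open. Let u, v, B : Ω → ℝ be twice differentiable with B > 0, u² + v² > 0, 1 + k₁B > 0, 1 + k₂B > 0 and v ≠ 0 on Ω; suppose ∂u/∂x¹ = ∂v/∂x², ∂u/∂x² = −∂v/∂x¹, and u·∂B/∂x¹ + v·∂B/∂x² = 0 on Ω. Define σ = ln( √B / ( √(u²+v²)·(1+k₁B)^{3/4}·(1+k₂B)^{1/4} ) ). Then at every point of Ω, −e^{−2σ}·(∂²σ/∂(x¹)² + ∂²σ/∂(x²)²) = −(u²+v²)/(4B²√(1+k₂B)) · { [2(1−k₁k₂B²)+(k₂−k₁)B]·√(1+k₁B)·(∂²B/∂(x¹)² + ∂²B/∂(x²)²) + (u²+v²)·(∂B/∂x¹)²·T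 / ( B·v²·(1+k₂B)·√(1+k₁B) ) }, where T = 2k₁k₂B³(k₁k₂B + k₁ − k₂) + (k₁² − k₂² − 8k₁k₂)B² − 4(k₁+k₂)B − 2. -/
/-- The logarithmic expansion of `σ`, with `W = u² + v²`. -/
theorem log_expand (k₁ k₂ b w : ℝ) (hb : 0 < b) (hw : 0 < w) (h1 : 0 < 1 + k₁ * b)
    (h2 : 0 < 1 + k₂ * b) :
    Real.log (Real.sqrt b / (Real.sqrt w * (1 + k₁ * b) ^ ((3 : ℝ) / 4) *
        (1 + k₂ * b) ^ ((1 : ℝ) / 4))) =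
      1 / 2 * Real.log b - 1 / 2 * Real.log w - 3 / 4 * Real.log (1 + k₁ * b)
        - 1 / 4 * Real.log (1 + k₂ * b) := by
  have hp := Real.rpow_pos_of_pos h1 ((3 : ℝ) / 4)
  have hq := Real.rpow_pos_of_pos h2 ((1 : ℝ) / 4)
  have hsw := Real.sqrt_pos.mpr hw
  have hsb := Real.sqrt_pos.mpr hb
  rw [Real.log_div hsb.ne' (by positivity), Real.log_mul (by positivity) hq.ne',
    Real.log_mul hsw.ne' hp.ne', Real.log_rpow h1, Real.log_rpow h2, Real.log_sqrt hb.le,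
    Real.log_sqrt hw.le]
  ring

/-- `e^{-2σ}` in closed form. -/
theorem exp_expand (k₁ k₂ b w : ℝ) (hb : 0 < b) (hw : 0 < w) (h1 : 0 < 1 + k₁ * b)
    (h2 : 0 < 1 + k₂ * b) :
    Real.exp (-(2 * (1 / 2 * Real.log b - 1 / 2 * Real.log w - 3 / 4 * Real.log (1 + k₁ * b)
        - 1 / 4 * Real.log (1 + k₂ * b)))) =
      w * ((1 + k₁ * b) * Real.sqrt (1 + k₁ * b)) * Real.sqrt (1 + k₂ * b) / b := by
  have hs1 := Real.sqrt_pos.mpr h1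
  have hs2 := Real.sqrt_pos.mpr h2
  rw [← Real.exp_log (show 0 < w * ((1 + k₁ * b) * Real.sqrt (1 + k₁ * b)) *
    Real.sqrt (1 + k₂ * b) / b by positivity)]
  rw [Real.log_div (by positivity) hb.ne', Real.log_mul (by positivity) hs2.ne',
    Real.log_mul hw.ne' (by positivity), Real.log_mul h1.ne' hs1.ne',
    Real.log_sqrt h1.le, Real.log_sqrt h2.le]
  congr 1
  ring

theorem first_deriv (k₁ k₂ : ℝ) (u v B : ℝ × ℝ → ℝ) (x e : ℝ × ℝ)
    (hu : DifferentiableAt ℝ u x) (hv : DifferentiableAt ℝ v x) (hB : DifferentiableAt ℝ B x)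
    (hb : 0 < B x) (hw : 0 < u x ^ 2 + v x ^ 2) (h1 : 0 < 1 + k₁ * B x)
    (h2 : 0 < 1 + k₂ * B x) :
    fderiv ℝ (fun y => 1 / 2 * Real.log (B y) - 1 / 2 * Real.log (u y ^ 2 + v y ^ 2)
      - 3 / 4 * Real.log (1 + k₁ * B y) - 1 / 4 * Real.log (1 + k₂ * B y)) x e =
    1 / 2 * (fderiv ℝ B x e * (B x)⁻¹)
      - (u x * fderiv ℝ u x e + v x * fderiv ℝ v x e) * (u x ^ 2 + v x ^ 2)⁻¹
      - 3 / 4 * k₁ * (fderiv ℝ B x e * (1 + k₁ * B x)⁻¹)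
      - 1 / 4 * k₂ * (fderiv ℝ B x e * (1 + k₂ * B x)⁻¹) := by
  have H := ((((hB.hasFDerivAt.log hb.ne').const_mul (1 / 2)).sub
    ((((hu.hasFDerivAt.pow 2).add (hv.hasFDerivAt.pow 2)).log hw.ne').const_mul (1 / 2))).sub
    ((((hB.hasFDerivAt.const_mul k₁).const_add 1).log h1.ne').const_mul (3 / 4))).sub
    ((((hB.hasFDerivAt.const_mul k₂).const_add 1).log h2.ne').const_mul (1 / 4))
  refine (congrArg (fun L => L e) (HasFDerivAt.fderiv H)).trans ?_
  simp
  ring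

theorem second_deriv (k₁ k₂ : ℝ) (u v B ue ve be : ℝ × ℝ → ℝ) (x e : ℝ × ℝ)
    (hu : DifferentiableAt ℝ u x) (hv : DifferentiableAt ℝ v x) (hB : DifferentiableAt ℝ B x)
    (hue : DifferentiableAt ℝ ue x) (hve : DifferentiableAt ℝ ve x)
    (hbe : DifferentiableAt ℝ be x)
    (hb : 0 < B x) (hw : 0 < u x ^ 2 + v x ^ 2) (h1 : 0 < 1 + k₁ * B x)
    (h2 : 0 < 1 + k₂ * B x) :
    fderiv ℝ (fun y => 1 / 2 * (be y * (B y)⁻¹)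
      - (u y * ue y + v y * ve y) * (u y ^ 2 + v y ^ 2)⁻¹
      - 3 / 4 * k₁ * (be y * (1 + k₁ * B y)⁻¹)
      - 1 / 4 * k₂ * (be y * (1 + k₂ * B y)⁻¹)) x e =
    1 / 2 * (fderiv ℝ be x e / B x - be x * fderiv ℝ B x e / (B x) ^ 2)
      - ((fderiv ℝ u x e * ue x + u x * fderiv ℝ ue x e + fderiv ℝ v x e * ve x
          + v x * fderiv ℝ ve x e) / (u x ^ 2 + v x ^ 2)
        - (u x * ue x + v x * ve x) * (2 * u x * fderiv ℝ u x e + 2 * v x * fderiv ℝ v x e)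
          / (u x ^ 2 + v x ^ 2) ^ 2)
      - 3 / 4 * k₁ * (fderiv ℝ be x e / (1 + k₁ * B x)
        - be x * (k₁ * fderiv ℝ B x e) / (1 + k₁ * B x) ^ 2)
      - 1 / 4 * k₂ * (fderiv ℝ be x e / (1 + k₂ * B x)
        - be x * (k₂ * fderiv ℝ B x e) / (1 + k₂ * B x) ^ 2) := by
  have inv : ∀ {f : ℝ × ℝ → ℝ} {L : ℝ × ℝ →L[ℝ] ℝ}, HasFDerivAt f L x → f x ≠ 0 →
      HasFDerivAt (fun y => (f y)⁻¹) ((-((f x) ^ 2)⁻¹) • L) x := by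
    intro f L hf h0
    exact (hasDerivAt_inv h0).comp_hasFDerivAt x hf
  have H := ((((hbe.hasFDerivAt.mul (inv hB.hasFDerivAt hb.ne')).const_mul (1 / 2)).sub
    (((hu.hasFDerivAt.mul hue.hasFDerivAt).add (hv.hasFDerivAt.mul hve.hasFDerivAt)).mul
      (inv ((hu.hasFDerivAt.pow 2).add (hv.hasFDerivAt.pow 2)) hw.ne'))).sub
    ((hbe.hasFDerivAt.mul
      (inv ((hB.hasFDerivAt.const_mul k₁).const_add 1) h1.ne')).const_mul (3 / 4 * k₁))).sub
    ((hbe.hasFDerivAt.mul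
      (inv ((hB.hasFDerivAt.const_mul k₂).const_add 1) h2.ne')).const_mul (1 / 4 * k₂))
  refine (congrArg (fun L => L e) (HasFDerivAt.fderiv H)).trans ?_
  simp
  ring

theorem fderiv_apply_fderiv (f : ℝ × ℝ → ℝ) (x e d : ℝ × ℝ)
    (hf : DifferentiableAt ℝ (fderiv ℝ f) x) :
    HasFDerivAt (fun y => fderiv ℝ f y e) ((fderiv ℝ (fderiv ℝ f) x).flip e) x := by
  have := hf.hasFDerivAt.clm_apply (hasFDerivAt_const e x)
  simpa using this

theorem mixed_symm (Ω : Set (ℝ × ℝ)) (hΩ : IsOpen Ω) (f : ℝ × ℝ → ℝ) (x : ℝ × ℝ) (hx : x ∈ Ω)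
    (hf : ∀ x ∈ Ω, DifferentiableAt ℝ f x)
    (hf' : DifferentiableAt ℝ (fderiv ℝ f) x) (e d : ℝ × ℝ) :
    fderiv ℝ (fun y => fderiv ℝ f y e) x d = fderiv ℝ (fun y => fderiv ℝ f y d) x e := by
  rw [(fderiv_apply_fderiv f x e d hf').fderiv, (fderiv_apply_fderiv f x d e hf').fderiv]
  have h : ∀ᶠ y in nhds x, HasFDerivAt f (fderiv ℝ f y) y := by
    filter_upwards [hΩ.mem_nhds hx] with y hy using (hf y hy).hasFDerivAt
  exact second_derivative_symmetric_of_eventually h hf'.hasFDerivAt d e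

/-- The final algebraic identity. -/
theorem final_alg (k₁ k₂ b u v b1 b2 u1 v1 u11 v11 b11 b22 p q : ℝ) (hb : 0 < b)
    (hw : 0 < u ^ 2 + v ^ 2) (h1 : 0 < 1 + k₁ * b) (h2 : 0 < 1 + k₂ * b) (hv : v ≠ 0)
    (hp : 0 < p) (hq : 0 < q) (hpp : p ^ 2 = 1 + k₁ * b) (hqq : q ^ 2 = 1 + k₂ * b)
    (hort : u * b1 + v * b2 = 0) :
    -(((u ^ 2 + v ^ 2) * ((1 + k₁ * b) * p) * q / b)) *
      ((1 / 2 * (b11 / b - b1 * b1 / b ^ 2)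
      - ((u1 * u1 + u * u11 + v1 * v1 + v * v11) / (u ^ 2 + v ^ 2)
        - (u * u1 + v * v1) * (2 * u * u1 + 2 * v * v1) / (u ^ 2 + v ^ 2) ^ 2)
      - 3 / 4 * k₁ * (b11 / (1 + k₁ * b) - b1 * (k₁ * b1) / (1 + k₁ * b) ^ 2)
      - 1 / 4 * k₂ * (b11 / (1 + k₂ * b) - b1 * (k₂ * b1) / (1 + k₂ * b) ^ 2)) +
      (1 / 2 * (b22 / b - b2 * b2 / b ^ 2)
      - ((-v1 * -v1 + u * -u11 + u1 * u1 + v * -v11) / (u ^ 2 + v ^ 2)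
        - (u * -v1 + v * u1) * (2 * u * -v1 + 2 * v * u1) / (u ^ 2 + v ^ 2) ^ 2)
      - 3 / 4 * k₁ * (b22 / (1 + k₁ * b) - b2 * (k₁ * b2) / (1 + k₁ * b) ^ 2)
      - 1 / 4 * k₂ * (b22 / (1 + k₂ * b) - b2 * (k₂ * b2) / (1 + k₂ * b) ^ 2))) =
    -((u ^ 2 + v ^ 2) / (4 * b ^ 2 * q)) *
      ((2 * (1 - k₁ * k₂ * b ^ 2) + (k₂ - k₁) * b) * p * (b11 + b22) +
        (u ^ 2 + v ^ 2) * b1 ^ 2 * (2 * k₁ * k₂ * b ^ 3 * (k₁ * k₂ * b + k₁ - k₂) +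
      (k₁ ^ 2 - k₂ ^ 2 - 8 * k₁ * k₂) * b ^ 2 - 4 * (k₁ + k₂) * b - 2) /
          (b * v ^ 2 * (1 + k₂ * b) * p)) := by
  have hb2 : b2 = -(u * b1) / v := by field_simp; linarith
  have hN : (1 / 2 * (b11 / b - b1 * b1 / b ^ 2)
      - ((u1 * u1 + u * u11 + v1 * v1 + v * v11) / (u ^ 2 + v ^ 2)
        - (u * u1 + v * v1) * (2 * u * u1 + 2 * v * v1) / (u ^ 2 + v ^ 2) ^ 2)
      - 3 / 4 * k₁ * (b11 / (1 + k₁ * b) - b1 * (k₁ * b1) / (1 + k₁ * b) ^ 2)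
      - 1 / 4 * k₂ * (b11 / (1 + k₂ * b) - b1 * (k₂ * b1) / (1 + k₂ * b) ^ 2)) +
      (1 / 2 * (b22 / b - b2 * b2 / b ^ 2)
      - ((-v1 * -v1 + u * -u11 + u1 * u1 + v * -v11) / (u ^ 2 + v ^ 2)
        - (u * -v1 + v * u1) * (2 * u * -v1 + 2 * v * u1) / (u ^ 2 + v ^ 2) ^ 2)
      - 3 / 4 * k₁ * (b22 / (1 + k₁ * b) - b2 * (k₁ * b2) / (1 + k₁ * b) ^ 2)
      - 1 / 4 * k₂ * (b22 / (1 + k₂ * b) - b2 * (k₂ * b2) / (1 + k₂ * b) ^ 2)) =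
      (b11 + b22) * (1 / (2 * b) - 3 / 4 * k₁ / (1 + k₁ * b) - 1 / 4 * k₂ / (1 + k₂ * b))
      + (b1 ^ 2 * (u ^ 2 + v ^ 2) / v ^ 2) * (-1 / (2 * b ^ 2)
        + 3 / 4 * k₁ ^ 2 / (1 + k₁ * b) ^ 2 + 1 / 4 * k₂ ^ 2 / (1 + k₂ * b) ^ 2) := by
    have hg : b1 ^ 2 * (u ^ 2 + v ^ 2) / v ^ 2 = b1 ^ 2 + b2 ^ 2 := by
      rw [hb2]; field_simp; ring
    have hh : ((u1 * u1 + u * u11 + v1 * v1 + v * v11) / (u ^ 2 + v ^ 2)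
        - (u * u1 + v * v1) * (2 * u * u1 + 2 * v * v1) / (u ^ 2 + v ^ 2) ^ 2) =
      -((-v1 * -v1 + u * -u11 + u1 * u1 + v * -v11) / (u ^ 2 + v ^ 2)
        - (u * -v1 + v * u1) * (2 * u * -v1 + 2 * v * u1) / (u ^ 2 + v ^ 2) ^ 2) := by
      field_simp
      ring
    rw [hg, hh]
    ring
  have n1 : 1 + b * k₁ ≠ 0 := by rw [mul_comm]; exact h1.ne'
  have n2 : 1 + b * k₂ ≠ 0 := by rw [mul_comm]; exact h2.ne'
  have e1 : 1 / (2 * b) - 3 / 4 * k₁ / (1 + k₁ * b) - 1 / 4 * k₂ / (1 + k₂ * b) =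
      (2 * (1 - k₁ * k₂ * b ^ 2) + (k₂ - k₁) * b) /
        (4 * b * (1 + k₁ * b) * (1 + k₂ * b)) := by
    field_simp
    ring
  have e2 : -1 / (2 * b ^ 2) + 3 / 4 * k₁ ^ 2 / (1 + k₁ * b) ^ 2
      + 1 / 4 * k₂ ^ 2 / (1 + k₂ * b) ^ 2 =
      (2 * k₁ * k₂ * b ^ 3 * (k₁ * k₂ * b + k₁ - k₂) +
      (k₁ ^ 2 - k₂ ^ 2 - 8 * k₁ * k₂) * b ^ 2 - 4 * (k₁ + k₂) * b - 2) /
        (4 * b ^ 2 * (1 + k₁ * b) ^ 2 * (1 + k₂ * b) ^ 2) := by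
    field_simp
    ring
  rw [hN, e1, e2]
  generalize 2 * (1 - k₁ * k₂ * b ^ 2) + (k₂ - k₁) * b = S
  generalize 2 * k₁ * k₂ * b ^ 3 * (k₁ * k₂ * b + k₁ - k₂) +
      (k₁ ^ 2 - k₂ ^ 2 - 8 * k₁ * k₂) * b ^ 2 - 4 * (k₁ + k₂) * b - 2 = T
  rw [← hpp, ← hqq]
  field_simp

/-- equation (3.28) of the paper. On an open `Ω ⊆ ℝ²`, with twice
differentiable `u, v, B` satisfying the positivity conditions, `v ≠ 0`, the
Cauchy–Riemann equations, and `uB₁ + vB₂ = 0`, the Gauss curvature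
`λ = -e^{-2σ}(σ₁₁ + σ₂₂)` of the metric `e^{2σ}δ_{ij}`, with
`σ = ln(√B/(√(u²+v²)(1+k₁B)^{3/4}(1+k₂B)^{1/4}))`, equals
`-(u²+v²)/(4B²√(1+k₂B))·{[2(1-k₁k₂B²)+(k₂-k₁)B]√(1+k₁B)(B₁₁+B₂₂)
  + (u²+v²)B₁²T/(Bv²(1+k₂B)√(1+k₁B))}`. -/
theorem stmt_13 (k₁ k₂ : ℝ) (Ω : Set (ℝ × ℝ)) (hΩ : IsOpen Ω)
    (u v B : ℝ × ℝ → ℝ)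
    (hu : ∀ x ∈ Ω, DifferentiableAt ℝ u x)
    (hu' : ∀ x ∈ Ω, DifferentiableAt ℝ (fderiv ℝ u) x)
    (hv : ∀ x ∈ Ω, DifferentiableAt ℝ v x)
    (hv' : ∀ x ∈ Ω, DifferentiableAt ℝ (fderiv ℝ v) x)
    (hB : ∀ x ∈ Ω, DifferentiableAt ℝ B x)
    (hB' : ∀ x ∈ Ω, DifferentiableAt ℝ (fderiv ℝ B) x)
    (hBpos : ∀ x ∈ Ω, 0 < B x)
    (huv : ∀ x ∈ Ω, 0 < u x ^ 2 + v x ^ 2)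
    (hk₁ : ∀ x ∈ Ω, 0 < 1 + k₁ * B x)
    (hk₂ : ∀ x ∈ Ω, 0 < 1 + k₂ * B x)
    (hvne : ∀ x ∈ Ω, v x ≠ 0)
    (hCR₁ : ∀ x ∈ Ω, fderiv ℝ u x (1, 0) = fderiv ℝ v x (0, 1))
    (hCR₂ : ∀ x ∈ Ω, fderiv ℝ u x (0, 1) = -fderiv ℝ v x (1, 0))
    (hBort : ∀ x ∈ Ω, u x * fderiv ℝ B x (1, 0) + v x * fderiv ℝ B x (0, 1) = 0)
    (σ : ℝ × ℝ → ℝ)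
    (hσ : σ = fun x => Real.log (Real.sqrt (B x) /
      (Real.sqrt (u x ^ 2 + v x ^ 2) * (1 + k₁ * B x) ^ ((3 : ℝ) / 4) *
        (1 + k₂ * B x) ^ ((1 : ℝ) / 4))))
    (T : ℝ × ℝ → ℝ)
    (hT : T = fun x => 2 * k₁ * k₂ * B x ^ 3 * (k₁ * k₂ * B x + k₁ - k₂) +
      (k₁ ^ 2 - k₂ ^ 2 - 8 * k₁ * k₂) * B x ^ 2 - 4 * (k₁ + k₂) * B x - 2) :
    ∀ x ∈ Ω,
      -Real.exp (-(2 * σ x)) *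
          (fderiv ℝ (fun y => fderiv ℝ σ y (1, 0)) x (1, 0) +
            fderiv ℝ (fun y => fderiv ℝ σ y (0, 1)) x (0, 1)) =
      -((u x ^ 2 + v x ^ 2) / (4 * B x ^ 2 * Real.sqrt (1 + k₂ * B x))) *
        ((2 * (1 - k₁ * k₂ * B x ^ 2) + (k₂ - k₁) * B x) * Real.sqrt (1 + k₁ * B x) *
            (fderiv ℝ (fun y => fderiv ℝ B y (1, 0)) x (1, 0) +
              fderiv ℝ (fun y => fderiv ℝ B y (0, 1)) x (0, 1)) +
          (u x ^ 2 + v x ^ 2) * fderiv ℝ B x (1, 0) ^ 2 * T x /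
            (B x * v x ^ 2 * (1 + k₂ * B x) * Real.sqrt (1 + k₁ * B x))) := by
  intro x hx
  have hnh := hΩ.mem_nhds hx
  have hσ' : ∀ y ∈ Ω, σ y = 1 / 2 * Real.log (B y) - 1 / 2 * Real.log (u y ^ 2 + v y ^ 2)
      - 3 / 4 * Real.log (1 + k₁ * B y) - 1 / 4 * Real.log (1 + k₂ * B y) := by
    intro y hy
    rw [hσ]
    exact log_expand k₁ k₂ _ _ (hBpos y hy) (huv y hy) (hk₁ y hy) (hk₂ y hy)
  have hσ1 : ∀ e : ℝ × ℝ, ∀ y ∈ Ω, fderiv ℝ σ y e =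
      1 / 2 * (fderiv ℝ B y e * (B y)⁻¹)
      - (u y * fderiv ℝ u y e + v y * fderiv ℝ v y e) * (u y ^ 2 + v y ^ 2)⁻¹
      - 3 / 4 * k₁ * (fderiv ℝ B y e * (1 + k₁ * B y)⁻¹)
      - 1 / 4 * k₂ * (fderiv ℝ B y e * (1 + k₂ * B y)⁻¹) := by
    intro e y hy
    rw [Filter.EventuallyEq.fderiv_eq (Filter.eventuallyEq_of_mem (hΩ.mem_nhds hy) hσ')]
    exact first_deriv k₁ k₂ u v B y e (hu y hy) (hv y hy) (hB y hy) (hBpos y hy) (huv y hy)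
      (hk₁ y hy) (hk₂ y hy)
  have hσ2 := fun e : ℝ × ℝ => second_deriv k₁ k₂ u v B (fun y => fderiv ℝ u y e)
    (fun y => fderiv ℝ v y e) (fun y => fderiv ℝ B y e) x e (hu x hx) (hv x hx) (hB x hx)
    (fderiv_apply_fderiv u x e e (hu' x hx)).differentiableAt
    (fderiv_apply_fderiv v x e e (hv' x hx)).differentiableAt
    (fderiv_apply_fderiv B x e e (hB' x hx)).differentiableAt
    (hBpos x hx) (huv x hx) (hk₁ x hx) (hk₂ x hx)
  have hu22 : fderiv ℝ (fun y => fderiv ℝ u y (0, 1)) x (0, 1) =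
      -fderiv ℝ (fun y => fderiv ℝ u y (1, 0)) x (1, 0) := by
    rw [Filter.EventuallyEq.fderiv_eq (Filter.eventuallyEq_of_mem hnh hCR₁),
      Filter.EventuallyEq.fderiv_eq (Filter.eventuallyEq_of_mem hnh hCR₂), fderiv_fun_neg,
      neg_apply, mixed_symm Ω hΩ v x hx hv (hv' x hx)]
  have hv22 : fderiv ℝ (fun y => fderiv ℝ v y (0, 1)) x (0, 1) =
      -fderiv ℝ (fun y => fderiv ℝ v y (1, 0)) x (1, 0) := by
    have hc : ∀ y ∈ Ω, fderiv ℝ v y (1, 0) = -fderiv ℝ u y (0, 1) := by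
      intro y hy
      rw [hCR₂ y hy, neg_neg]
    rw [← Filter.EventuallyEq.fderiv_eq (Filter.eventuallyEq_of_mem hnh hCR₁),
      Filter.EventuallyEq.fderiv_eq (Filter.eventuallyEq_of_mem hnh hc), fderiv_fun_neg,
      neg_apply, mixed_symm Ω hΩ u x hx hu (hu' x hx), neg_neg]
  rw [Filter.EventuallyEq.fderiv_eq (Filter.eventuallyEq_of_mem hnh (hσ1 (1, 0))),
    Filter.EventuallyEq.fderiv_eq (Filter.eventuallyEq_of_mem hnh (hσ1 (0, 1))),
    hσ2, hσ2, hu22, hv22, hCR₂ x hx, ← hCR₁ x hx, hσ' x hx,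
    exp_expand k₁ k₂ _ _ (hBpos x hx) (huv x hx) (hk₁ x hx) (hk₂ x hx), hT]
  exact final_alg k₁ k₂ (B x) (u x) (v x) (fderiv ℝ B x (1, 0)) (fderiv ℝ B x (0, 1))
    _ _ _ _ _ _ _ _ (hBpos x hx) (huv x hx) (hk₁ x hx) (hk₂ x hx) (hvne x hx)
    (Real.sqrt_pos.mpr (hk₁ x hx)) (Real.sqrt_pos.mpr (hk₂ x hx))
    (Real.sq_sqrt (hk₁ x hx).le) (Real.sq_sqrt (hk₂ x hx).le) (hBort x hx)
end

section
/- Let k₁, k₂, B, u, v, W, B₁, P be real numbers with B > 0, v ≠ 0, 1 + k₁B > 0, 1 + k₂B > 0, W = u² + v², and D := 2(1 − k₁k₂B²) + (k₂ − k₁)B ≠ 0, and 4 + (k₁+3k₂)B ≠ 0. Define λ = −W/(4B²√(1+k₂B)) · { D·√(1+k₁B)·P + W·(B₁/v)²·T / ( B·(1+k₂B)·√(1+k₁B) ) } with T = 2k₁k₂B³(k₁k₂B + k₁ − k₂) + (k₁² − k₂² − 8k₁k₂)B² − 4(k₁+k₂)B − 2; define S = [4+(k₁+3k₂)B]²·W²·(B₁/v)²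 / ( 64B·√(1+k₁B)·(1+k₂B)^{3/2} ), and A₂ = 2k₁²k₂²B³ + 5k₁k₂(k₁+k₂)B² + k₁(k₁+13k₂)B + 2(2k₁+k₂). Then 2(1+k₂B)/D · ( λ − 8A₂·S / ( B·[4+(k₁+3k₂)B]² ) ) = −W·√(1+k₂B)/(4B²) · ( 2√(1+k₁B)·P − W·(2+3k₁B)·(B₁/v)² / ( B·√(1+k₁B) ) ). -/
/-- The purely algebraic identity by which the paper passes from the
flag-curvature formula (3.25) to the final formula (1.6) of Theorem 1.1. -/
theorem stmt_14 (k₁ k₂ B u v W B₁ P D lam S A₂ T : ℝ)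
    (hB : 0 < B) (hv : v ≠ 0)
    (hk₁ : 0 < 1 + k₁ * B) (hk₂ : 0 < 1 + k₂ * B)
    (hW : W = u ^ 2 + v ^ 2)
    (hD : D = 2 * (1 - k₁ * k₂ * B ^ 2) + (k₂ - k₁) * B) (hDne : D ≠ 0)
    (hden : 4 + (k₁ + 3 * k₂) * B ≠ 0)
    (hT : T = 2 * k₁ * k₂ * B ^ 3 * (k₁ * k₂ * B + k₁ - k₂) +
      (k₁ ^ 2 - k₂ ^ 2 - 8 * k₁ * k₂) * B ^ 2 - 4 * (k₁ + k₂) * B - 2)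
    (hlam : lam = -(W / (4 * B ^ 2 * Real.sqrt (1 + k₂ * B))) *
      (D * Real.sqrt (1 + k₁ * B) * P +
        W * (B₁ / v) ^ 2 * T / (B * (1 + k₂ * B) * Real.sqrt (1 + k₁ * B))))
    (hS : S = (4 + (k₁ + 3 * k₂) * B) ^ 2 * W ^ 2 * (B₁ / v) ^ 2 /
      (64 * B * Real.sqrt (1 + k₁ * B) * (1 + k₂ * B) ^ ((3 : ℝ) / 2)))
    (hA₂ : A₂ = 2 * k₁ ^ 2 * k₂ ^ 2 * B ^ 3 + 5 * k₁ * k₂ * (k₁ + k₂) * B ^ 2 +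
      k₁ * (k₁ + 13 * k₂) * B + 2 * (2 * k₁ + k₂)) :
    2 * (1 + k₂ * B) / D *
        (lam - 8 * A₂ * S / (B * (4 + (k₁ + 3 * k₂) * B) ^ 2)) =
      -(W * Real.sqrt (1 + k₂ * B) / (4 * B ^ 2)) *
        (2 * Real.sqrt (1 + k₁ * B) * P -
          W * (2 + 3 * k₁ * B) * (B₁ / v) ^ 2 / (B * Real.sqrt (1 + k₁ * B))) := by
  have key : -(2 * T + A₂ * B) = D * (1 + k₂ * B) * (2 + 3 * k₁ * B) := by
    rw [hT, hA₂, hD]; ring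
  have hpow : (1 + k₂ * B) ^ ((3 : ℝ) / 2) = (1 + k₂ * B) * Real.sqrt (1 + k₂ * B) := by
    rw [Real.sqrt_eq_rpow, show (3 : ℝ) / 2 = 1 + 1 / 2 by norm_num,
      Real.rpow_add hk₂, Real.rpow_one]
  have hp : Real.sqrt (1 + k₁ * B) ≠ 0 := (Real.sqrt_pos.mpr hk₁).ne'
  have hr : Real.sqrt (1 + k₂ * B) ≠ 0 := (Real.sqrt_pos.mpr hk₂).ne'
  have hr2 : 1 + k₂ * B = Real.sqrt (1 + k₂ * B) ^ 2 := (Real.sq_sqrt hk₂.le).symm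
  rw [hpow] at hS
  have hT' : T = -(D * (1 + k₂ * B) * (2 + 3 * k₁ * B) + A₂ * B) / 2 := by
    linarith
  rw [hlam, hS, hT']
  clear hT hT' hlam hS hpow key hA₂ hD hW hk₁
  generalize Real.sqrt (1 + k₁ * B) = p at *
  generalize Real.sqrt (1 + k₂ * B) = r at *
  generalize 4 + (k₁ + 3 * k₂) * B = E at *
  generalize B₁ / v = X at *
  rw [hr2]
  have hB' := hB.ne'
  field_simp
  ring
end

section
/- Let k₁ < k₂ be real constants, b > 0 with 1 + k₁b² > 0, ε ∈ {1, −1}, c = √(k₂−k₁), and let φ(s) = ((1+k₁s²)(1+k₂s²))^{1/4}·exp(∫₀ˢ εc/(2(1+k₁t²)√(1+k₂t²)) dt). Then φ(s) − s·φ′(s) > 0 for all real s with |s| ≤ b. -/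
/-- second of Shen's positive-definiteness conditions, verified in the
proof of Lemma 3.1. Let `k₁ < k₂`, `b > 0` with `1 + k₁b² > 0`, `ε ∈ {1, -1}`,
`c = √(k₂-k₁)` and `φ` as in (1.2). Then `φ(s) - s·φ'(s) > 0` for all `|s| ≤ b`. -/
theorem stmt_15 (k₁ k₂ b ε c : ℝ) (hk : k₁ < k₂) (hb : 0 < b)
    (hpd : 0 < 1 + k₁ * b ^ 2)
    (hε : ε = 1 ∨ ε = -1) (hc : c = Real.sqrt (k₂ - k₁))
    (φ : ℝ → ℝ)
    (hφ : φ = fun s : ℝ => ((1 + k₁ * s ^ 2) * (1 + k₂ * s ^ 2)) ^ ((1 : ℝ) / 4) *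
      Real.exp (∫ t in (0 : ℝ)..s,
        ε * c / (2 * (1 + k₁ * t ^ 2) * Real.sqrt (1 + k₂ * t ^ 2)))) :
    ∀ s : ℝ, |s| ≤ b → 0 < φ s - s * deriv φ s := by
  have hA : ∀ t : ℝ, |t| ≤ b → 0 < 1 + k₁ * t ^ 2 := by
    intro t ht
    have h1 : t ^ 2 ≤ b ^ 2 := sq_le_sq' (abs_le.1 ht).1 (abs_le.1 ht).2
    rcases le_or_gt 0 k₁ with h | h
    · positivity
    · nlinarith
  have hB : ∀ t : ℝ, |t| ≤ b → 0 < 1 + k₂ * t ^ 2 := by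
    intro t ht
    have := hA t ht
    nlinarith [sq_nonneg t]
  intro s hs
  have hAs := hA s hs
  have hBs := hB s hs
  have hcont : ∀ t : ℝ, |t| ≤ b → ContinuousAt (fun t : ℝ =>
      ε * c / (2 * (1 + k₁ * t ^ 2) * Real.sqrt (1 + k₂ * t ^ 2))) t := by
    intro t ht
    have h1 := hA t ht
    have h2 := Real.sqrt_pos.2 (hB t ht)
    refine ContinuousAt.div (by fun_prop) (by fun_prop) (by positivity)
  have hI : HasDerivAt (fun s : ℝ => ∫ t in (0 : ℝ)..s,
        ε * c / (2 * (1 + k₁ * t ^ 2) * Real.sqrt (1 + k₂ * t ^ 2)))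
      (ε * c / (2 * (1 + k₁ * s ^ 2) * Real.sqrt (1 + k₂ * s ^ 2))) s := by
    refine intervalIntegral.integral_hasDerivAt_right ?_ ?_ (hcont s hs)
    · apply ContinuousOn.intervalIntegrable
      intro t ht
      refine (hcont t ?_).continuousWithinAt
      have := Set.abs_sub_left_of_mem_uIcc ht
      simp only [sub_zero] at this
      exact this.trans hs
    · refine Measurable.stronglyMeasurable ?_ |>.stronglyMeasurableAtFilter
      fun_prop
  have hP : HasDerivAt (fun s : ℝ => (1 + k₁ * s ^ 2) * (1 + k₂ * s ^ 2))
      (2 * k₁ * s * (1 + k₂ * s ^ 2) + (1 + k₁ * s ^ 2) * (2 * k₂ * s)) s := by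
    have h1 : ∀ k : ℝ, HasDerivAt (fun s : ℝ => 1 + k * s ^ 2) (2 * k * s) s := by
      intro k
      have := ((hasDerivAt_pow 2 s).const_mul k).const_add 1
      refine HasDerivAt.congr_deriv this ?_
      norm_num
      ring
    exact (h1 k₁).mul (h1 k₂)
  have hABpos : 0 < (1 + k₁ * s ^ 2) * (1 + k₂ * s ^ 2) := by positivity
  have hD := (hP.rpow_const (p := (1 : ℝ) / 4) (Or.inl hABpos.ne')).mul hI.exp
  have hD' := (hD.congr_of_eventuallyEq (f₁ := φ)
    (Filter.Eventually.of_forall fun x => by rw [hφ]; rfl)).deriv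
  rw [hD', hφ, Real.rpow_sub_one hABpos.ne']
  beta_reduce
  have hX := Real.rpow_pos_of_pos hABpos ((1 : ℝ) / 4)
  have hE := Real.exp_pos (∫ t in (0 : ℝ)..s,
        ε * c / (2 * (1 + k₁ * t ^ 2) * Real.sqrt (1 + k₂ * t ^ 2)))
  generalize ((1 + k₁ * s ^ 2) * (1 + k₂ * s ^ 2)) ^ ((1 : ℝ) / 4) = X at hX ⊢
  generalize Real.exp (∫ t in (0 : ℝ)..s,
        ε * c / (2 * (1 + k₁ * t ^ 2) * Real.sqrt (1 + k₂ * t ^ 2))) = E at hE ⊢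
  have hr := Real.sqrt_pos.2 hBs
  have hr2 := Real.sq_sqrt hBs.le
  generalize Real.sqrt (1 + k₂ * s ^ 2) = r at hr hr2 ⊢
  have hc2 : c ^ 2 = k₂ - k₁ := by rw [hc, Real.sq_sqrt (by linarith)]
  have hε2 : ε ^ 2 = 1 := by rcases hε with h | h <;> rw [h] <;> norm_num
  have hq2 : (ε * c * s) ^ 2 = r ^ 2 - (1 + k₁ * s ^ 2) := by
    rw [mul_pow, mul_pow, hε2, hc2, hr2]; ring
  have hlt : |ε * c * s| < r := abs_lt_of_sq_lt_sq (by linarith) hr.le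
  obtain ⟨h1, h2⟩ := abs_lt.1 hlt
  have hfac : 0 < (r - ε * c * s) * (r + ε * c * s / 2) :=
    mul_pos (by linarith) (by linarith)
  rw [← hr2]
  obtain ⟨A, hAd⟩ : ∃ A, A = 1 + k₁ * s ^ 2 := ⟨_, rfl⟩
  rw [← hAd] at hAs hq2 ⊢
  have key : X * E / (A * r ^ 2) * ((r - ε * c * s) * (r + ε * c * s / 2)) =
      X * E - s * ((2 * k₁ * s * r ^ 2 + A * (2 * k₂ * s)) * (1 / 4) * (X / (A * r ^ 2)) * E
        + X * (E * (ε * c / (2 * A * r)))) := by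
    have e1 : (r - ε * c * s) * (r + ε * c * s / 2) =
        A * r ^ 2 - ((A - 1) * r ^ 2 + A * (r ^ 2 - 1)) / 2 - ε * c * s * r / 2 := by
      linear_combination (-1 / 2) * hq2
    have e2 : A - 1 = k₁ * s ^ 2 := by rw [hAd]; ring
    have e3 : r ^ 2 - 1 = k₂ * s ^ 2 := by rw [hr2]; ring
    rw [e1, e2, e3]
    field_simp
    ring
  have : 0 < X * E / (A * r ^ 2) * ((r - ε * c * s) * (r + ε * c * s / 2)) := by positivity
  rw [key] at this
  exact this
end
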